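/- In the clipping ANN setting, assume additionally that f and p are piecewise polynomial, and let Θ ∈ C([0, ∞), ℝ^{h+1}) be a gradient flow trajectory. Then there exist ϑ ∈ ℝ^{h+1} and α, C ∈ (0, ∞) such that for all t ∈ [0, ∞) it holds that ‖Θ_t − ϑ‖ ≤ C (1 + t)^{−α}, 0 ≤ L(Θ_t) − L(ϑ) ≤ C (1 + t)^{−1}, and limsup_{s→∞} ‖Θ_s − ϑ‖ = 0, where ‖·‖ denotes the Euclidean norm. -/

import Mathlib

open MeasureTheory Filter

noncomputable section

/-- The clipping function `x ↦ min{max{x,0},1}`. -/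
def clipFn (x : ℝ) : ℝ := min (max x 0) 1

/-- `ψ_i(θ) = -θ_i / w_i`. -/
def psiC {h : ℕ} (w : Fin h → ℝ) (θ : Fin (h + 1) → ℝ) (i : Fin h) : ℝ :=
  -θ i.castSucc / w i

/-- The activity interval `I_i^θ = (ψ_i(θ), ψ_i(θ) + 1/w_i) ∩ (a, b)`. -/
def actI {h : ℕ} (a b : ℝ) (w : Fin h → ℝ) (θ : Fin (h + 1) → ℝ) (i : Fin h) : Set ℝ :=
  Set.Ioo (psiC w θ i) (psiC w θ i + (w i)⁻¹) ∩ Set.Ioo a b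

/-- The realization function `N^θ(x) = θ_{h+1} + ∑_i v_i c(w_i x + θ_i)`. -/
def realC {h : ℕ} (v w : Fin h → ℝ) (θ : Fin (h + 1) → ℝ) (x : ℝ) : ℝ :=
  θ (Fin.last h) + ∑ i : Fin h, v i * clipFn (w i * x + θ i.castSucc)

/-- The risk `L(θ) = ∫_a^b (N^θ(x) - f(x))² p(x) dx`. -/
def riskC {h : ℕ} (a b : ℝ) (v w : Fin h → ℝ) (f p : ℝ → ℝ) (θ : Fin (h + 1) → ℝ) : ℝ :=
  ∫ x in Set.Ioo a b, (realC v w θ x - f x) ^ 2 * p x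

/-- The gradient `∇L(θ)` as a vector of partial derivatives. -/
def gradC {h : ℕ} (a b : ℝ) (v w : Fin h → ℝ) (f p : ℝ → ℝ) (θ : Fin (h + 1) → ℝ) :
    Fin (h + 1) → ℝ :=
  fun k => fderiv ℝ (riskC a b v w f p) θ (Pi.single k 1)

/-- `x` is a descending critical point of `g` : `∇g(x) = 0` and the Hessian quadratic form
admits a negative value. -/
def IsDescCrit {n : ℕ} (g : (Fin n → ℝ) → ℝ) (x : Fin n → ℝ) : Prop :=
  fderiv ℝ g x = 0 ∧ ∃ u : Fin n → ℝ, iteratedFDeriv ℝ 2 g x ![u, u] < 0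

/-- The Euclidean norm on `Fin n → ℝ`. -/
def euclNorm {n : ℕ} (x : Fin n → ℝ) : ℝ := Real.sqrt (∑ i, (x i) ^ 2)

/-- Piecewise polynomial functions. -/
def PiecewisePoly (F : ℝ → ℝ) : Prop :=
  ∃ (K : ℕ) (τ : ℕ → EReal), 0 < K ∧ τ 0 = ⊥ ∧ τ K = ⊤ ∧
    (∀ k, k < K → τ k < τ (k + 1)) ∧
    ∀ k, k < K → ∃ q : Polynomial ℝ, ∀ x : ℝ,
      τ k < (x : EReal) → (x : EReal) < τ (k + 1) → F x = q.eval x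

/-- The hyperreals as an algebra over the reals. -/
instance hyperrealAlgebra : Algebra ℝ Hyperreal := Hyperreal.coeRingHom.toRingHom.toAlgebra

namespace HyperrealCurve

open ArchimedeanClass Polynomial

theorem mk_algebraMap_nonneg (r : ℝ) : 0 ≤ mk (algebraMap ℝ Hyperreal r) :=
  Hyperreal.archimedeanClassMk_coe_nonneg r

theorem mk_algebraMap {r : ℝ} (hr : r ≠ 0) : mk (algebraMap ℝ Hyperreal r) = 0 :=
  Hyperreal.archimdeanClassMk_coe hr

theorem aeval_eq_coeff_zero_add (t : Hyperreal) (q : ℝ[X]) :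
    aeval t q = algebraMap ℝ Hyperreal (q.coeff 0) + t * aeval t q.divX := by
  conv_lhs => rw [← Polynomial.divX_mul_X_add q, map_add, map_mul, aeval_X, aeval_C]
  ring

theorem mk_aeval_nonneg {t : Hyperreal} (ht : 0 ≤ mk t) (q : ℝ[X]) : 0 ≤ mk (aeval t q) := by
  induction q using Polynomial.induction_on' with
  | add p q hp hq =>
    rw [map_add]
    exact (le_min hp hq).trans (min_le_mk_add _ _)
  | monomial n a =>
    rw [Polynomial.aeval_monomial, mk_mul, mk_pow]
    exact add_nonneg (mk_algebraMap_nonneg a) (nsmul_nonneg ht n)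

theorem mk_aeval_eq_zero {t : Hyperreal} (ht : 0 < mk t) {q : ℝ[X]} (hq : q.coeff 0 ≠ 0) :
    mk (aeval t q) = 0 := by
  have h := mk_aeval_nonneg ht.le q.divX
  rw [aeval_eq_coeff_zero_add, mk_add_eq_mk_left] <;> rw [mk_algebraMap hq]
  rw [mk_mul]
  exact lt_of_lt_of_le ht (le_add_of_nonneg_right h)

theorem mk_le_mk_aeval {t : Hyperreal} (ht : 0 < mk t) {q : ℝ[X]} (hq : q.coeff 0 = 0) :
    mk t ≤ mk (aeval t q) := by
  have h := mk_aeval_nonneg ht.le q.divX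
  rw [aeval_eq_coeff_zero_add, hq, map_zero, zero_add, mk_mul]
  exact le_add_of_nonneg_right h

theorem transcendental_of_infinitesimal {t : Hyperreal} (ht : 0 < mk t) (ht0 : t ≠ 0) :
    Transcendental ℝ t := by
  rw [transcendental_iff]
  intro q
  induction h : q.natDegree using Nat.strong_induction_on generalizing q with
  | _ n ih =>
    intro hq
    have h0 : q.coeff 0 = 0 := by
      by_contra hne
      have := mk_aeval_eq_zero ht hne
      simp [hq] at this
    rw [aeval_eq_coeff_zero_add, h0, map_zero, zero_add] at hq
    have hd : aeval t q.divX = 0 := (mul_eq_zero.1 hq).resolve_left ht0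
    rcases Nat.eq_zero_or_pos n with hn | hn
    · rw [Polynomial.eq_C_of_natDegree_eq_zero (h.trans hn), h0, map_zero]
    · have := ih q.divX.natDegree (by rw [Polynomial.natDegree_divX_eq_natDegree_tsub_one]; omega)
        q.divX rfl hd
      rw [← Polynomial.divX_mul_X_add q, this, h0]; simp

/-- Dominance: elements of pairwise distinct orders strictly between `1` and `t` satisfy no
nontrivial linear relation with coefficients that are polynomials in `t`. -/
theorem polynomial_relation_trivial {ι : Type*} [LinearOrder ι] {t : Hyperreal} (ht : 0 < mk t)
    (ht0 : t ≠ 0) {z : ι → Hyperreal} (hz : StrictMono fun i => mk (z i)) (hz0 : ∀ i, 0 ≤ mk (z i))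
    (hzt : ∀ i, mk (z i) < mk t) (s : Finset ι) (n : ℕ) (p : ι → ℝ[X])
    (hdeg : ∀ i ∈ s, (p i).degree < n) (hrel : ∑ i ∈ s, aeval t (p i) * z i = 0) :
    ∀ i ∈ s, p i = 0 := by
  induction n generalizing p with
  | zero =>
    intro i hi
    have := hdeg i hi
    rwa [Nat.cast_zero, Nat.WithBot.lt_zero_iff, Polynomial.degree_eq_bot] at this
  | succ n ih =>
    have h0 : ∀ i ∈ s, (p i).coeff 0 = 0 := by
      by_contra! hne
      obtain ⟨j, hj, hjne⟩ := hne
      set T := s.filter fun i => (p i).coeff 0 ≠ 0 with hT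
      have hTne : T.Nonempty := ⟨j, by simp [hT, hj, hjne]⟩
      set m := T.min' hTne
      have hm : m ∈ T := T.min'_mem hTne
      have hms : m ∈ s := (Finset.mem_filter.1 hm).1
      have hm0 : (p m).coeff 0 ≠ 0 := (Finset.mem_filter.1 hm).2
      have hvm : mk (aeval t (p m) * z m) = mk (z m) := by
        rw [mk_mul, mk_aeval_eq_zero ht hm0, zero_add]
      rw [← Finset.add_sum_erase s _ hms] at hrel
      have hbig : mk (z m) < mk (∑ i ∈ s.erase m, aeval t (p i) * z i) := by
        have := AddValuation.map_lt_sum (addValuation Hyperreal) (s := s.erase m)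
          (f := fun i => aeval t (p i) * z i) (g := mk (z m)) (ne_top_of_lt (hzt m)) ?_
        · simpa using this
        · intro i hi
          rw [addValuation_apply, mk_mul]
          obtain ⟨him, his⟩ := Finset.mem_erase.1 hi
          by_cases hi0 : (p i).coeff 0 = 0
          · exact (hzt m).trans_le ((mk_le_mk_aeval ht hi0).trans
              (le_add_of_nonneg_right (hz0 i)))
          · rw [mk_aeval_eq_zero ht hi0, zero_add]
            have : m ≤ i := T.min'_le i (Finset.mem_filter.2 ⟨his, hi0⟩)
            exact hz (lt_of_le_of_ne this (Ne.symm him))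
      have := mk_add_eq_mk_left (hvm.symm ▸ hbig)
      rw [hrel, hvm, mk_zero] at this
      exact absurd this.symm (ne_top_of_lt (hzt m))
    have hdiv : ∀ i ∈ s, p i = (p i).divX * X := fun i hi => by
      conv_lhs => rw [← Polynomial.divX_mul_X_add (p i), h0 i hi]
      simp
    have key := ih (fun i => (p i).divX) ?_ ?_
    · intro i hi
      rw [hdiv i hi, key i hi, zero_mul]
    · intro i hi
      by_cases hp : p i = 0
      · simp [hp]
      have := Polynomial.degree_divX_lt hp
      have h2 := hdeg i hi
      rw [Polynomial.degree_lt_iff_coeff_zero] at h2 ⊢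
      intro k hk
      rw [Polynomial.coeff_divX]
      exact h2 _ (by omega)
    · have : t * ∑ i ∈ s, aeval t (p i).divX * z i = 0 := by
        rw [Finset.mul_sum, ← hrel]
        refine Finset.sum_congr rfl fun i hi => ?_
        conv_rhs => rw [hdiv i hi]
        simp; ring
      exact (mul_eq_zero.1 this).resolve_left ht0

open IntermediateField

theorem linearIndependent_of_strictMono {ι : Type*} [LinearOrder ι] {t : Hyperreal} (ht : 0 < mk t)
    (ht0 : t ≠ 0) {z : ι → Hyperreal} (hz : StrictMono fun i => mk (z i)) (hz0 : ∀ i, 0 ≤ mk (z i))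
    (hzt : ∀ i, mk (z i) < mk t) : LinearIndependent ℝ⟮t⟯ z := by
  classical
  rw [linearIndependent_iff']
  intro s g hg
  have hrs : ∀ i, ∃ r q : ℝ[X], aeval t q ≠ 0 ∧ (g i : Hyperreal) = aeval t r / aeval t q := by
    intro i
    obtain ⟨r, q, h⟩ := IntermediateField.mem_adjoin_simple_iff ℝ (g i : Hyperreal) |>.1 (g i).2
    by_cases hq : aeval t q = 0
    · exact ⟨0, 1, by simp, by simp [h, hq]⟩
    · exact ⟨r, q, hq, h⟩
  choose r q hq hgr using hrs
  set p : ι → ℝ[X] := fun i => r i * ∏ j ∈ s.erase i, q j with hp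
  obtain ⟨n, hn⟩ : ∃ n : ℕ, ∀ i ∈ s, (p i).degree < n := by
    refine ⟨s.sup (fun i => (p i).natDegree) + 1, fun i hi => ?_⟩
    refine lt_of_le_of_lt Polynomial.degree_le_natDegree ?_
    have : (p i).natDegree ≤ s.sup (fun i => (p i).natDegree) :=
      Finset.le_sup (f := fun i => (p i).natDegree) hi
    exact_mod_cast Nat.lt_succ_of_le this
  have hrel : ∑ i ∈ s, aeval t (p i) * z i = 0 := by
    have : (∏ j ∈ s, aeval t (q j)) * ∑ i ∈ s, g i • z i = 0 := by rw [hg, mul_zero]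
    rw [Finset.mul_sum] at this
    rw [← this]
    refine Finset.sum_congr rfl fun i hi => ?_
    rw [IntermediateField.smul_def, smul_eq_mul, hgr i, hp, ← Finset.mul_prod_erase s _ hi]
    have := hq i
    simp only [map_mul, map_prod]
    field_simp
  intro i hi
  have h0 := polynomial_relation_trivial ht ht0 hz hz0 hzt s n p hn hrel i hi
  have : r i = 0 := by
    rw [hp, mul_eq_zero] at h0
    refine h0.resolve_right ?_
    rw [← ne_eq, Finset.prod_ne_zero_iff]
    intro j _ hj
    exact hq j (by simp [hj])
  ext
  rw [hgr i, this]; simp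

/-- A uniformizer of the finite elements of a finite extension of `ℝ(t)`. -/
theorem exists_uniformizer {t : Hyperreal} (ht : 0 < mk t) (ht0 : t ≠ 0)
    (E : IntermediateField ℝ⟮t⟯ Hyperreal)
    [FiniteDimensional ℝ⟮t⟯ E] : ∃ π ∈ E, 0 < mk π ∧ π ≠ 0 ∧ (∀ z ∈ E, 0 < mk z → mk π ≤ mk z) ∧
      ∃ e : ℕ, 0 < e ∧ mk t = e • mk π := by
  have htE : t ∈ E := by
    have := E.algebraMap_mem ⟨t, IntermediateField.mem_adjoin_simple_self ℝ t⟩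
    exact this
  have hnot : ∀ {ι : Type} [LinearOrder ι] [Infinite ι] (z : ι → Hyperreal), (∀ i, z i ∈ E) →
      StrictMono (fun i => mk (z i)) → (∀ i, 0 ≤ mk (z i)) → (∀ i, mk (z i) < mk t) → False := by
    intro ι _ _ z hzE h1 h2 h3
    have hli := linearIndependent_of_strictMono ht ht0 h1 h2 h3
    have hli' : LinearIndependent ℝ⟮t⟯ (fun i => (⟨z i, hzE i⟩ : E)) :=
      LinearIndependent.of_comp E.val.toLinearMap hli
    have := hli'.finite
    exact not_finite ι
  obtain ⟨π, hπE, hπ, hπ0, hmin⟩ : ∃ π ∈ E, 0 < mk π ∧ π ≠ 0 ∧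
      ∀ z ∈ E, 0 < mk z → mk π ≤ mk z := by
    by_contra! hcon
    have hstep : ∀ x : {x : Hyperreal // x ∈ E ∧ 0 < mk x ∧ x ≠ 0},
        ∃ y : {x : Hyperreal // x ∈ E ∧ 0 < mk x ∧ x ≠ 0}, mk y.1 < mk x.1 := by
      rintro ⟨x, hxE, hx, hx0⟩
      obtain ⟨y, hyE, hy, hlt⟩ := hcon x hxE hx hx0
      exact ⟨⟨y, hyE, hy, fun h => by simp [h] at hlt⟩, hlt⟩
    choose f hf using hstep
    let s : ℕ → {x : Hyperreal // x ∈ E ∧ 0 < mk x ∧ x ≠ 0} := fun n => f^[n] ⟨t, htE, ht, ht0⟩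
    have hs : StrictAnti fun n => mk (s n).1 := strictAnti_nat_of_succ_lt fun n => by
      simp only [s, Function.iterate_succ_apply']
      exact hf _
    refine hnot (ι := ℕᵒᵈ) (fun i => (s (OrderDual.ofDual i + 1)).1) (fun i => (s _).2.1) ?_
      (fun i => (s _).2.2.1.le) (fun i => hs (Nat.succ_pos _))
    intro i j hij
    exact hs (Nat.succ_lt_succ hij)
  refine ⟨π, hπE, hπ, hπ0, hmin, ?_⟩
  have hπt : mk π ≠ ⊤ := by simpa using hπ0
  have hex : ∃ k : ℕ, mk t ≤ k • mk π := by
    by_contra! hcon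
    refine hnot (ι := ℕ) (fun k => π ^ k) (fun k => pow_mem hπE k) ?_
      (fun k => by rw [mk_pow]; exact nsmul_nonneg hπ.le k) (fun k => by rw [mk_pow]; exact hcon k)
    refine strictMono_nat_of_lt_succ fun n => ?_
    rw [mk_pow, mk_pow, succ_nsmul]
    refine lt_of_le_of_ne (le_add_of_nonneg_right hπ.le) fun h => hπ.ne ?_
    have hn : n • mk π ≠ ⊤ := ne_top_of_lt (hcon n)
    exact add_left_cancel_of_ne_top hn (by rw [add_zero, ← h])
  classical
  have hk := Nat.find_spec hex
  have hkm := fun {m} => Nat.find_min hex (m := m)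
  set k := Nat.find hex
  have hk0 : 0 < k := by
    by_contra h
    have : k = 0 := by omega
    rw [this, zero_nsmul] at hk
    exact absurd ht (not_lt.2 hk)
  refine ⟨k, hk0, le_antisymm hk ?_⟩
  obtain ⟨m, hm⟩ : ∃ m, k = m + 1 := ⟨k - 1, by omega⟩
  have hlt : m • mk π < mk t := not_le.1 (hkm (by omega))
  set u := t / π ^ m with hu
  have hut : t = π ^ m * u := by rw [hu]; field_simp
  have hmk : mk t = m • mk π + mk u := by
    conv_lhs => rw [hut]
    rw [mk_mul, mk_pow]
  have hupos : 0 < mk u := by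
    by_contra h
    rw [not_lt] at h
    have : m • mk π + mk u ≤ m • mk π + 0 := by gcongr
    rw [← hmk, add_zero] at this
    exact absurd hlt (not_lt.2 this)
  have := hmin u (div_mem htE (pow_mem hπE m)) hupos
  rw [hm, succ_nsmul, hmk]
  gcongr

theorem mk_nonneg_of_pow_mul {t : Hyperreal} (ht : 0 < mk t) (ht0 : t ≠ 0)
    (E : IntermediateField ℝ⟮t⟯ Hyperreal)
    [FiniteDimensional ℝ⟮t⟯ E] {z : Hyperreal} (hzE : z ∈ E) (hz : ∀ k : ℕ, 0 < mk (z ^ k * t)) :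
    0 ≤ mk z := by
  by_contra! hneg
  obtain ⟨π, -, -, -, hmin, e, -, he⟩ := exists_uniformizer ht ht0 E
  have hz0 : z ≠ 0 := fun h => by simp [h] at hneg
  have hzt : mk z ≠ ⊤ := by simpa using hz0
  have hinv : 0 < mk z⁻¹ := by
    by_contra! h
    have h1 : mk z + mk z⁻¹ = 0 := by rw [← mk_mul, mul_inv_cancel₀ hz0, mk_one]
    have : mk z + mk z⁻¹ ≤ mk z + 0 := by gcongr
    rw [h1, add_zero] at this
    exact absurd hneg (not_lt.2 this)
  have h2 := hmin _ (inv_mem hzE) hinv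
  have h3 := hz e
  have : mk t ≤ mk (z⁻¹ ^ e) := by rw [he, mk_pow]; exact nsmul_le_nsmul_right h2 e
  have h4 : mk (z ^ e * t) ≤ mk (z ^ e * z⁻¹ ^ e) := by rw [mk_mul, mk_mul]; gcongr
  rw [← mul_pow, mul_inv_cancel₀ hz0, one_pow, mk_one] at h4
  exact absurd h3 (not_lt.2 h4)

end HyperrealCurve

namespace HyperrealCurve

section TaylorExpansion

variable {O : Type*} [CommRing O] [IsDomain O] [Algebra ℝ O]

/-- A residue map with principal kernel embeds a real algebra in the real power series. -/
theorem exists_taylor_algHom (st : O →ₐ[ℝ] ℝ) {ϖ : O} (hϖ : ϖ ≠ 0) (hst : st ϖ = 0)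
    (hker : ∀ z, st z = 0 → ϖ ∣ z) :
    ∃ Φ : O →ₐ[ℝ] PowerSeries ℝ, Φ ϖ = PowerSeries.X ∧
      ∀ z, PowerSeries.constantCoeff (Φ z) = st z := by
  have hex : ∀ z, ∃ y, z = algebraMap ℝ O (st z) + ϖ * y := fun z => by
    obtain ⟨y, hy⟩ := hker (z - algebraMap ℝ O (st z)) (by simp)
    exact ⟨y, by rw [← hy]; ring⟩
  choose σ hσ using hex
  have huniq : ∀ z y, z = algebraMap ℝ O (st z) + ϖ * y → σ z = y := fun z y h =>
    mul_left_cancel₀ hϖ (add_left_cancel ((hσ z).symm.trans h))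
  let Ψ : O → PowerSeries ℝ := fun z => PowerSeries.mk fun k => st (σ^[k] z)
  have hzero : ∀ z, PowerSeries.coeff 0 (Ψ z) = st z := fun z => by simp [Ψ]
  have hsucc : ∀ k z, PowerSeries.coeff (k + 1) (Ψ z) = PowerSeries.coeff k (Ψ (σ z)) :=
    fun k z => by simp [Ψ]
  have hΨ : ∀ z, Ψ z = PowerSeries.C (st z) + PowerSeries.X * Ψ (σ z) := fun z => by
    ext k
    cases k with
    | zero => simp [hzero]
    | succ k => rw [hsucc, map_add, PowerSeries.coeff_succ_X_mul, PowerSeries.coeff_C]; simp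
  have hσadd : ∀ z w, σ (z + w) = σ z + σ w := fun z w => huniq _ _ (by
    rw [map_add, map_add, mul_add]
    nth_rw 1 [hσ z, hσ w]; ring)
  have hσmul : ∀ z w, σ (z * w) = algebraMap ℝ O (st z) * σ w + σ z * w := fun z w => huniq _ _ (by
    rw [map_mul, map_mul]
    nth_rw 1 [hσ z]
    have h2 := hσ w
    linear_combination (algebraMap ℝ O (st z)) * h2)
  have hσalg : ∀ r, σ (algebraMap ℝ O r) = 0 := fun r => huniq _ _ (by simp)
  have hΨadd : ∀ z w, Ψ (z + w) = Ψ z + Ψ w := fun z w => by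
    ext k
    induction k generalizing z w with
    | zero => simp only [map_add, hzero]
    | succ k ih => rw [map_add, hsucc, hsucc, hsucc, hσadd, ih, map_add]
  have hΨalg : ∀ r, Ψ (algebraMap ℝ O r) = PowerSeries.C r := fun r => by
    have h0 : Ψ 0 = 0 := by
      have := hΨadd 0 0
      rwa [add_zero, left_eq_add] at this
    rw [hΨ, hσalg, h0]; simp
  have hΨmul : ∀ k z w, PowerSeries.coeff k (Ψ (z * w)) = PowerSeries.coeff k (Ψ z * Ψ w) := by
    intro k
    induction k with
    | zero =>
      intro z w
      simp only [PowerSeries.coeff_zero_eq_constantCoeff] at hzero ⊢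
      rw [hzero, map_mul, map_mul, hzero, hzero]
    | succ k ih =>
      intro z w
      have : Ψ z * Ψ w = PowerSeries.C (st z) * Ψ w + PowerSeries.X * (Ψ (σ z) * Ψ w) := by
        rw [hΨ z]; simp only [hΨ (σ z)]; ring
      rw [hsucc, hσmul, hΨadd, map_add, ih, ih, hΨalg, this, map_add, PowerSeries.coeff_succ_X_mul,
        PowerSeries.coeff_C_mul, PowerSeries.coeff_C_mul, hsucc]
  refine ⟨{ toFun := Ψ
            map_one' := by simpa using hΨalg 1
            map_mul' := fun z w => PowerSeries.ext fun k => hΨmul k z w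
            map_zero' := by simpa using hΨalg 0
            map_add' := hΨadd
            commutes' := hΨalg }, ?_, fun z => ?_⟩
  · change Ψ ϖ = _
    have h1 : σ ϖ = 1 := huniq _ _ (by simp [hst])
    have h2 : Ψ 1 = 1 := by simpa using hΨalg 1
    rw [hΨ, h1, h2, hst]; simp
  · exact (PowerSeries.coeff_zero_eq_constantCoeff_apply _).symm.trans (hzero z)

theorem derivation_aeval {n : ℕ} {A : Type*} [CommRing A] [Algebra ℝ A] (D : Derivation ℝ A A)
    (y : Fin n → A) (P : MvPolynomial (Fin n) ℝ) :
    D (MvPolynomial.aeval y P) = ∑ i, MvPolynomial.aeval y (MvPolynomial.pderiv i P) * D (y i) := by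
  classical
  induction P using MvPolynomial.induction_on with
  | C a => simp
  | add p q hp hq => simp only [map_add, hp, hq, add_mul, Finset.sum_add_distrib]
  | mul_X p j hp =>
    simp only [map_mul, Derivation.leibniz, hp, MvPolynomial.aeval_X, smul_eq_mul, map_add,
      MvPolynomial.pderiv_X, add_mul, Finset.sum_add_distrib, Finset.mul_sum]
    congr 1
    · rw [Finset.sum_eq_single j]
      · simp
      · intro i _ hij; simp [hij.symm]
      · simp
    · exact Finset.sum_congr rfl fun i _ => by ring

/-- Along a formal curve, a polynomial vanishing at the centre does not divide all of its partial
derivatives. -/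
theorem not_dvd_pderiv_along_curve (st : O →ₐ[ℝ] ℝ) {ϖ : O} (hϖ : ϖ ≠ 0) (hst : st ϖ = 0)
    (hker : ∀ z, st z = 0 → ϖ ∣ z) {n : ℕ} (P : MvPolynomial (Fin n) ℝ) (y w : Fin n → O)
    {e : ℕ} (he : 0 < e) {u : O} (hu : st u ≠ 0) (hP : MvPolynomial.aeval y P = ϖ ^ e * u)
    (hw : ∀ i, MvPolynomial.aeval y (MvPolynomial.pderiv i P) = MvPolynomial.aeval y P * w i) :
    False := by
  obtain ⟨Φ, hΦϖ, hΦ⟩ := exists_taylor_algHom st hϖ hst hker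
  have h1 : Φ (MvPolynomial.aeval y P) = PowerSeries.X ^ e * Φ u := by rw [hP]; simp [hΦϖ]
  have h2 := derivation_aeval (PowerSeries.derivative ℝ) (fun i => Φ (y i)) P
  have h3 : ∀ Q : MvPolynomial (Fin n) ℝ, MvPolynomial.aeval (fun i => Φ (y i)) Q =
      Φ (MvPolynomial.aeval y Q) := fun Q => by
    rw [← AlgHom.comp_apply, MvPolynomial.comp_aeval]
  simp only [h3, hw, map_mul, h1] at h2
  obtain ⟨m, rfl⟩ : ∃ m, e = m + 1 := ⟨e - 1, by omega⟩
  set S := ∑ i, Φ (w i) * (PowerSeries.derivative ℝ) (Φ (y i)) with hS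
  have h4 : (PowerSeries.derivative ℝ) (PowerSeries.X ^ (m + 1) * Φ u) =
      PowerSeries.X ^ (m + 1) * (Φ u * S) := by
    rw [h2, hS, Finset.mul_sum, Finset.mul_sum]
    exact Finset.sum_congr rfl fun i _ => by ring
  rw [Derivation.leibniz, Derivation.leibniz_pow] at h4
  simp only [PowerSeries.derivative_X, smul_eq_mul, Nat.add_sub_cancel, nsmul_eq_mul, mul_one] at h4
  have h5 : PowerSeries.X ^ m * (((m + 1 : ℕ) : PowerSeries ℝ) * Φ u) =
      PowerSeries.X ^ m * (PowerSeries.X * (Φ u * S - (PowerSeries.derivative ℝ) (Φ u))) := by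
    linear_combination h4
  have h6 := mul_left_cancel₀ (pow_ne_zero m PowerSeries.X_ne_zero) h5
  have h7 := congrArg PowerSeries.constantCoeff h6
  simp only [map_mul, map_natCast, PowerSeries.constantCoeff_X, zero_mul, hΦ] at h7
  exact (mul_ne_zero (Nat.cast_ne_zero.2 m.succ_ne_zero) hu) h7

end TaylorExpansion

end HyperrealCurve

namespace HyperrealCurve
open ArchimedeanClass Polynomial IntermediateField

/-- Over a finite extension of `ℝ(t)` inside the hyperreals, no finite point `y` has all partial
derivatives of a polynomial of order at least that of its infinitesimal nonzero value. -/
theorem false_of_mk_pderiv {t : Hyperreal} (ht : 0 < mk t) (ht0 : t ≠ 0)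
    (E : IntermediateField ℝ⟮t⟯ Hyperreal)
    [FiniteDimensional ℝ⟮t⟯ E] {n : ℕ} (P : MvPolynomial (Fin n) ℝ) (y : Fin n → Hyperreal)
    (hyE : ∀ i, y i ∈ E) (hy : ∀ i, 0 ≤ mk (y i)) (hP : mk (MvPolynomial.aeval y P) = mk t)
    (hw : ∀ i, mk t ≤ mk (MvPolynomial.aeval y (MvPolynomial.pderiv i P))) : False := by
  obtain ⟨ϖ, hϖE, hϖ, hϖ0, hmin, e, he, hte⟩ := exists_uniformizer ht ht0 E
  have halg : ∀ r : ℝ, algebraMap ℝ Hyperreal r ∈ E := fun r =>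
    E.algebraMap_mem (algebraMap ℝ ℝ⟮t⟯ r)
  let O : Subalgebra ℝ Hyperreal :=
    { carrier := {z | z ∈ E ∧ 0 ≤ mk z}
      mul_mem' := fun {a b} ha hb => ⟨mul_mem ha.1 hb.1, by
        rw [mk_mul]; exact add_nonneg ha.2 hb.2⟩
      add_mem' := fun {a b} ha hb => ⟨add_mem ha.1 hb.1,
        (le_min ha.2 hb.2).trans (min_le_mk_add _ _)⟩
      algebraMap_mem' := fun r => ⟨halg r, mk_algebraMap_nonneg r⟩ }
  let st : O →ₐ[ℝ] ℝ :=
    { toFun := fun z => stdPart z.1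
      map_one' := stdPart_one
      map_mul' := fun z w => stdPart_mul z.2.2 w.2.2
      map_zero' := stdPart_zero
      map_add' := fun z w => stdPart_add z.2.2 w.2.2
      commutes' := fun r => Hyperreal.stdPart_coe r }
  have hdiv : ∀ z x : Hyperreal, mk x ≤ mk z → x ≠ 0 → 0 ≤ mk (z / x) := fun z x h hx => by
    by_contra! hneg
    have hxt : mk x ≠ ⊤ := by simpa using hx
    have h1 : mk z = mk x + mk (z / x) := by rw [← mk_mul, mul_div_cancel₀ _ hx]
    have h2 : mk x + mk (z / x) ≤ mk x + 0 := by gcongr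
    rw [add_zero, ← h1] at h2
    have h3 := le_antisymm h h2
    rw [← h3] at h1
    exact hneg.ne (add_left_cancel_of_ne_top hxt (by rw [add_zero, ← h1]))
  have hpow : mk (ϖ ^ e) = mk t := by rw [mk_pow, hte]
  have hval : ∀ Q : MvPolynomial (Fin n) ℝ,
      ((MvPolynomial.aeval (fun i => (⟨y i, hyE i, hy i⟩ : O)) Q : O) : Hyperreal) =
        MvPolynomial.aeval y Q := fun Q => by
    have := MvPolynomial.comp_aeval_apply (fun i => (⟨y i, hyE i, hy i⟩ : O)) O.val Q
    exact this
  have hPE : ∀ Q : MvPolynomial (Fin n) ℝ, MvPolynomial.aeval y Q ∈ E := fun Q => by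
    rw [← hval]; exact (Subtype.property (p := (· ∈ O)) _).1
  have hP0 : MvPolynomial.aeval y P ≠ 0 := fun h => by
    rw [h, mk_zero] at hP
    exact ht0 (mk_eq_top_iff.1 hP.symm)
  have hϖe : ϖ ^ e ≠ 0 := pow_ne_zero _ hϖ0
  let u : O := ⟨MvPolynomial.aeval y P / ϖ ^ e, div_mem (hPE P) (pow_mem hϖE e),
    hdiv _ _ (by rw [hP, hpow]) hϖe⟩
  let w : Fin n → O := fun i => ⟨MvPolynomial.aeval y (MvPolynomial.pderiv i P) /
    MvPolynomial.aeval y P, div_mem (hPE _) (hPE P), hdiv _ _ (by rw [hP]; exact hw i) hP0⟩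
  refine not_dvd_pderiv_along_curve st (ϖ := ⟨ϖ, hϖE, hϖ.le⟩) ?_ ?_ ?_ P
    (fun i => (⟨y i, hyE i, hy i⟩ : O)) w he (u := u) ?_ ?_ ?_
  · exact fun h => hϖ0 (congrArg Subtype.val h)
  · exact stdPart_eq_zero.2 hϖ.ne'
  · intro z hz
    have h1 : 0 < mk z.1 := lt_of_le_of_ne z.2.2 (stdPart_eq_zero.1 hz).symm
    exact ⟨⟨z.1 / ϖ, div_mem z.2.1 hϖE, hdiv _ _ (hmin _ z.2.1 h1) hϖ0⟩,
      Subtype.ext (mul_div_cancel₀ z.1 hϖ0).symm⟩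
  · intro h
    have h1 : mk u.1 ≠ 0 := stdPart_eq_zero.1 h
    have h2 : mk (ϖ ^ e) + mk u.1 = mk (ϖ ^ e) + 0 := by
      rw [← mk_mul, add_zero, mul_div_cancel₀ _ hϖe, hP, hpow]
    exact h1 (add_left_cancel_of_ne_top (mt mk_eq_top_iff.1 hϖe) h2)
  · apply Subtype.ext
    rw [hval]
    exact (mul_div_cancel₀ _ hϖe).symm
  · intro i
    apply Subtype.ext
    rw [hval]
    refine (mul_div_cancel₀ (MvPolynomial.aeval y (MvPolynomial.pderiv i P)) hP0).symm.trans ?_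
    change _ = (_ : Hyperreal) * _
    rw [hval]

end HyperrealCurve

namespace HyperrealCurve
open IntermediateField

theorem exists_algebraicIndependent_real {F : Type} [Field F] [Algebra F ℝ]
    (hF : Cardinal.mk F ≤ Cardinal.aleph0) (n : ℕ) :
    ∃ c : Fin n → ℝ, AlgebraicIndependent F c := by
  obtain ⟨s, hs⟩ := exists_isTranscendenceBasis F ℝ
  have hinf : Infinite s := by
    by_contra hfin
    rw [not_infinite_iff_finite] at hfin
    have halg := hs.isAlgebraic_field
    have h1 := Algebra.IsAlgebraic.cardinalMk_le_max
      (IntermediateField.adjoin F (Set.range ((↑) : s → ℝ))) ℝ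
    have h2 := IntermediateField.cardinalMk_adjoin_le F (Set.range ((↑) : s → ℝ))
    have h3 : Cardinal.mk (Set.range ((↑) : s → ℝ)) ≤ Cardinal.aleph0 := by
      rw [Cardinal.le_aleph0_iff_set_countable]
      exact (Set.finite_range _).countable
    have h4 : Cardinal.mk ℝ ≤ Cardinal.aleph0 :=
      h1.trans (max_le (h2.trans (max_le (max_le hF h3) le_rfl)) le_rfl)
    rw [Cardinal.mk_real] at h4
    exact absurd h4 (not_le.2 Cardinal.aleph0_lt_continuum)
  obtain ⟨g⟩ : Nonempty (ℕ ↪ s) := ⟨Infinite.natEmbedding s⟩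
  exact ⟨fun i => (g i : ℝ), hs.1.comp (fun i : Fin n => g i)
    fun i j h => Fin.ext (g.injective h)⟩

theorem finiteDimensional_adjoin_of_algebraicIndependent {F A : Type} [Field F] [Field A]
    [Algebra ℝ A] [Algebra F ℝ] [Algebra F A] [IsScalarTower F ℝ A] {n : ℕ} {c : Fin n → ℝ}
    (hc : AlgebraicIndependent F c) {t : A} (ht : Transcendental ℝ t) (y : Fin n → A) (k : ℕ)
    (hcy : ∀ i, t ^ k * algebraMap ℝ A (c i) ∈ Algebra.adjoin F (insert t (Set.range y))) :
    FiniteDimensional ℝ⟮t⟯ (IntermediateField.adjoin ℝ⟮t⟯ (Set.range y)) := by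
  have ht0 : t ≠ 0 := fun h => ht (h ▸ isAlgebraic_zero)
  have hind : AlgebraicIndependent F (Sum.elim (fun _ : Unit => t) (algebraMap ℝ A ∘ c)) :=
    hc.sumElim_comp ((algebraicIndependent_unique_type_iff (x := fun _ : Unit => t)).2 ht)
  set C := Set.range (Sum.elim (fun _ : Unit => t) (algebraMap ℝ A ∘ c)) with hC
  set Y : Set A := insert t (Set.range y) with hY
  set m := AlgebraicIndependent.matroid F A
  have hCind : m.Indep C := AlgebraicIndependent.matroid_indep_iff.2 hind.to_subtype_range
  have hCY : C ⊆ m.closure Y := by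
    rw [AlgebraicIndependent.matroid_closure_eq]
    rintro _ ⟨i | i, rfl⟩
    · exact isAlgebraic_algebraMap
        (⟨t, Algebra.subset_adjoin (Set.mem_insert _ _)⟩ : Algebra.adjoin F Y)
    · have h1 : IsAlgebraic (Algebra.adjoin F Y) (t ^ k * algebraMap ℝ A (c i)) :=
        isAlgebraic_algebraMap (⟨_, hcy i⟩ : Algebra.adjoin F Y)
      have h2 : IsAlgebraic (Algebra.adjoin F Y) t := isAlgebraic_algebraMap
        (⟨t, Algebra.subset_adjoin (Set.mem_insert _ _)⟩ : Algebra.adjoin F Y)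
      have h3 := (h2.pow k).inv.mul h1
      rwa [inv_mul_cancel_left₀ (pow_ne_zero k ht0)] at h3
  have hcard : Y.encard ≤ C.encard := by
    have h1 : C.encard = n + 1 := by
      rw [hC, ← Set.image_univ, hind.injective.encard_image, Set.encard_univ]
      simp [add_comm]
    rw [h1]
    refine (Set.encard_insert_le _ _).trans ?_
    gcongr
    rw [← Set.image_univ]
    refine (Set.encard_image_le _ _).trans ?_
    simp [Set.encard_univ]
  have hCfin : C.Finite := Set.finite_range _
  have hbas : m.IsBasis C (m.closure Y) := by
    rw [Matroid.isBasis_iff_indep_encard_eq_of_finite hCfin]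
    refine ⟨hCY, hCind, le_antisymm (hCind.encard_le_eRk_of_subset hCY) ?_⟩
    rw [Matroid.eRk_closure_eq]
    exact (m.eRk_le_encard Y).trans hcard
  have hyC : ∀ i, y i ∈ m.closure C := fun i =>
    hbas.subset_closure (m.mem_closure_of_mem (Set.mem_insert_of_mem _ ⟨i, rfl⟩)
      (Set.subset_univ _))
  refine IntermediateField.finiteDimensional_adjoin ?_
  rintro _ ⟨i, rfl⟩
  have hi := hyC i
  rw [AlgebraicIndependent.matroid_closure_eq] at hi
  have hle : ∀ z ∈ Algebra.adjoin F C, z ∈ ℝ⟮t⟯ := fun z hz => by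
    have : Algebra.adjoin F C ≤ (ℝ⟮t⟯.toSubalgebra).restrictScalars F := by
      rw [Algebra.adjoin_le_iff]
      rintro _ ⟨j | j, rfl⟩
      · exact IntermediateField.mem_adjoin_simple_self ℝ t
      · exact ℝ⟮t⟯.algebraMap_mem (c j)
    exact this hz
  let g : Algebra.adjoin F C →+* ℝ⟮t⟯ :=
    { toFun := fun z => ⟨z.1, hle z.1 z.2⟩
      map_one' := rfl
      map_mul' := fun _ _ => rfl
      map_zero' := rfl
      map_add' := fun _ _ => rfl }
  have := IsAlgebraic.ringHom_of_comp_eq (S := ℝ⟮t⟯) (B := A) g (RingHom.id A)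
    (a := y i) hi (fun a b h => Subtype.ext (congrArg (fun z => z.1) h)) rfl
  exact this.isIntegral

end HyperrealCurve

namespace MvPolynomialCalculus
open MvPolynomial

theorem hasFDerivAt_eval {n : ℕ} (P : MvPolynomial (Fin n) ℝ) (x : Fin n → ℝ) :
    HasFDerivAt (fun z : Fin n → ℝ => eval z P)
      (∑ i, eval x (pderiv i P) • (ContinuousLinearMap.proj i : (Fin n → ℝ) →L[ℝ] ℝ)) x := by
  induction P using MvPolynomial.induction_on with
  | C a => simpa using hasFDerivAt_const a x
  | add p q hp hq =>
    simp only [map_add, add_smul, Finset.sum_add_distrib]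
    exact hp.add hq
  | mul_X p j hp =>
    have h := hp.mul (ContinuousLinearMap.proj (R := ℝ) (φ := fun _ : Fin n => ℝ) j).hasFDerivAt
      (x := x)
    simp only [map_mul, eval_X]
    refine h.congr_fderiv ?_
    ext v
    have h1 : ∑ i, eval x p * (eval x (Pi.single (M :=
        fun _ => MvPolynomial (Fin n) ℝ) i 1 j)) * v i =
        eval x p * v j := by
      rw [Finset.sum_eq_single j]
      · simp
      · intro i _ hij; simp [hij.symm]
      · simp
    simp only [add_apply, smul_apply,
      sum_apply, ContinuousLinearMap.proj_apply, smul_eq_mul,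
      Derivation.leibniz, pderiv_X, map_add, map_mul, eval_X, add_mul, Finset.sum_add_distrib,
      Finset.mul_sum, h1]
    congr 1
    exact Finset.sum_congr rfl fun i _ => by ring

theorem eval_pderiv_eq_zero_of_isLocalMin {n : ℕ} {P : MvPolynomial (Fin n) ℝ} {y : Fin n → ℝ}
    (hy : IsLocalMin (fun z => eval z P) y) (i : Fin n) : eval y (pderiv i P) = 0 := by
  have h := hy.hasFDerivAt_eq_zero (hasFDerivAt_eval P y)
  have := congrArg (fun l : (Fin n → ℝ) →L[ℝ] ℝ => l (Pi.single i 1)) h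
  simp only [sum_apply, smul_apply,
    ContinuousLinearMap.proj_apply, smul_eq_mul, zero_apply] at this
  rw [Finset.sum_eq_single i] at this
  · simpa using this
  · intro j _ hij; simp [hij]
  · simp

/-- The squared distance penalty selecting a point close to the level set `P = t`. -/
def penalty {n : ℕ} (P : MvPolynomial (Fin n) ℝ) (c : Fin n → ℝ) (t : ℝ) :
    MvPolynomial (Fin n) ℝ :=
  C (t ^ 2) * ∑ j, pderiv j P ^ 2 + (P - C t) ^ 2 + C (t ^ 4) * ∑ j, (X j - C (c j)) ^ 2

theorem eval_penalty {n : ℕ} (P : MvPolynomial (Fin n) ℝ) (c : Fin n → ℝ) (t : ℝ)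
    (x : Fin n → ℝ) : eval x (penalty P c t) =
      t ^ 2 * ∑ j, eval x (pderiv j P) ^ 2 + (eval x P - t) ^ 2 + t ^ 4 * ∑ j, (x j - c j) ^ 2 := by
  simp [penalty]

theorem exists_penalty_minimizer {n : ℕ} (P : MvPolynomial (Fin n) ℝ) (c : Fin n → ℝ) {t : ℝ}
    (ht : t ≠ 0) : ∃ y, ∀ x, eval y (penalty P c t) ≤ eval x (penalty P c t) := by
  have hcont : Continuous fun x => eval x (penalty P c t) := MvPolynomial.continuous_eval _
  set R := eval c (penalty P c t) / t ^ 4 + 1 with hR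
  have ht4 : 0 < t ^ 4 := by positivity
  have hHc : 0 ≤ eval c (penalty P c t) := by rw [eval_penalty]; positivity
  have hR1 : 1 ≤ R := by rw [hR]; linarith [div_nonneg hHc ht4.le]
  obtain ⟨y, -, hy⟩ := (isCompact_closedBall c R).exists_isMinOn
    ⟨c, Metric.mem_closedBall_self (by linarith)⟩ hcont.continuousOn
  refine ⟨y, fun x => ?_⟩
  by_cases hx : x ∈ Metric.closedBall c R
  · exact hy hx
  refine (hy (Metric.mem_closedBall_self (by linarith))).trans ?_
  rw [Metric.mem_closedBall, dist_pi_le_iff (by linarith)] at hx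
  push Not at hx
  obtain ⟨i, hi⟩ := hx
  rw [Real.dist_eq] at hi
  have h1 : R ≤ (x i - c i) ^ 2 := by
    rw [← sq_abs]; nlinarith
  have h2 : (x i - c i) ^ 2 ≤ ∑ j, (x j - c j) ^ 2 :=
    Finset.single_le_sum (f := fun j => (x j - c j) ^ 2) (fun j _ => sq_nonneg _)
      (Finset.mem_univ i)
  have h3 : eval c (penalty P c t) ≤ t ^ 4 * R := by
    rw [hR, mul_add, mul_div_cancel₀ _ ht4.ne']; linarith
  have h4 : t ^ 4 * R ≤ t ^ 4 * ∑ j, (x j - c j) ^ 2 := by gcongr; exact h1.trans h2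
  refine (h3.trans h4).trans ?_
  rw [eval_penalty]
  have : 0 ≤ t ^ 2 * ∑ j, eval x (pderiv j P) ^ 2 := by positivity
  nlinarith [sq_nonneg (eval x P - t)]

theorem pderiv_penalty {n : ℕ} (P : MvPolynomial (Fin n) ℝ) (c : Fin n → ℝ) (t : ℝ) (i : Fin n)
    (y : Fin n → ℝ) : eval y (pderiv i (penalty P c t)) =
      2 * (t ^ 2 * ∑ j, eval y (pderiv j P) * eval y (pderiv i (pderiv j P)) +
        (eval y P - t) * eval y (pderiv i P) + t ^ 4 * (y i - c i)) := by
  have h1 : ∑ j, eval y (2 * (X j - C (c j)) * (Pi.single (M :=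
      fun _ => MvPolynomial (Fin n) ℝ) i 1 j)) =
      2 * (y i - c i) := by
    rw [Finset.sum_eq_single i]
    · simp
    · intro j _ hij; simp [hij]
    · simp
  simp only [penalty, map_add, Derivation.leibniz, Derivation.leibniz_pow, map_sum, map_sub,
    pderiv_C, pderiv_X, smul_eq_mul, nsmul_eq_mul, map_mul, eval_C, map_pow, sub_zero, mul_zero,
    add_zero, eval_X] at h1 ⊢
  simp only [Nat.cast_ofNat, map_ofNat, pow_one, Nat.reduceSub] at h1 ⊢
  have h2 : ∑ j, 2 * (eval y (pderiv j P) * eval y (pderiv i (pderiv j P))) =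
    2 * ∑ j, eval y (pderiv j P) * eval y (pderiv i (pderiv j P)) := by rw [Finset.mul_sum]
  simp only [← mul_assoc] at h1 h2 ⊢
  rw [h1, h2]
  ring

/-- A minimizer of the penalty recovers the centre `c` algebraically, and is controlled by the
value of the penalty at any point of the level set. -/
theorem exists_penalty_critical {n : ℕ} (P : MvPolynomial (Fin n) ℝ) (c : Fin n → ℝ)
    (x : Fin n → ℝ) {t B : ℝ} (ht : t ≠ 0) (hx : eval x P = t)
    (hB : ∑ j, eval x (pderiv j P) ^ 2 + t ^ 2 * ∑ j, (x j - c j) ^ 2 ≤ t ^ 2 * B) :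
    ∃ y : Fin n → ℝ,
      (∀ i, t ^ 4 * c i = t ^ 4 * y i +
        t ^ 2 * ∑ j, eval y (pderiv j P) * eval y (pderiv i (pderiv j P)) +
        (eval y P - t) * eval y (pderiv i P)) ∧
      (∀ i, eval y (pderiv i P) ^ 2 ≤ t ^ 2 * B) ∧ (eval y P - t) ^ 2 ≤ t ^ 4 * B ∧
      ∀ i, (y i - c i) ^ 2 ≤ B := by
  obtain ⟨y, hy⟩ := exists_penalty_minimizer P c ht
  have ht2 : 0 < t ^ 2 := by positivity
  have ht4 : 0 < t ^ 4 := by positivity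
  have hH : eval y (penalty P c t) ≤ t ^ 4 * B := by
    refine (hy x).trans ?_
    rw [eval_penalty, hx]
    nlinarith
  rw [eval_penalty] at hH
  have h1 : 0 ≤ t ^ 2 * ∑ j, eval y (pderiv j P) ^ 2 := by positivity
  have h2 : 0 ≤ t ^ 4 * ∑ j, (y j - c j) ^ 2 := by positivity
  refine ⟨y, fun i => ?_, fun i => ?_, ?_, fun i => ?_⟩
  · have h := eval_pderiv_eq_zero_of_isLocalMin (Filter.Eventually.of_forall hy) i
    rw [pderiv_penalty] at h
    linarith
  · have h3 : eval y (pderiv i P) ^ 2 ≤ ∑ j, eval y (pderiv j P) ^ 2 :=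
      Finset.single_le_sum (f := fun j => eval y (pderiv j P) ^ 2) (fun j _ => sq_nonneg _)
        (Finset.mem_univ i)
    have h4 : t ^ 2 * eval y (pderiv i P) ^ 2 ≤ t ^ 2 * (t ^ 2 * B) := by
      have := mul_le_mul_of_nonneg_left h3 ht2.le
      nlinarith [sq_nonneg (eval y P - t)]
    exact le_of_mul_le_mul_left h4 ht2
  · linarith
  · have h3 : (y i - c i) ^ 2 ≤ ∑ j, (y j - c j) ^ 2 :=
      Finset.single_le_sum (f := fun j => (y j - c j) ^ 2) (fun j _ => sq_nonneg _)
        (Finset.mem_univ i)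
    have h4 : t ^ 4 * (y i - c i) ^ 2 ≤ t ^ 4 * B := by
      have := mul_le_mul_of_nonneg_left h3 ht4.le
      nlinarith [sq_nonneg (eval y P - t)]
    exact le_of_mul_le_mul_left h4 ht4

end MvPolynomialCalculus

namespace HyperrealCurve
open ArchimedeanClass IntermediateField Topology

theorem aeval_ofSeq {n : ℕ} (y : ℕ → Fin n → ℝ) (Q : MvPolynomial (Fin n) ℝ) :
    MvPolynomial.aeval (fun i => Hyperreal.ofSeq fun m => y m i) Q =
      Hyperreal.ofSeq fun m => MvPolynomial.eval (y m) Q := by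
  induction Q using MvPolynomial.induction_on with
  | C a => simp only [MvPolynomial.aeval_C, MvPolynomial.eval_C]; rfl
  | add p q hp hq => simp only [map_add, hp, hq]; rfl
  | mul_X p i hp => simp only [map_mul, hp, MvPolynomial.aeval_X, MvPolynomial.eval_X]; rfl

theorem ofSeq_le_of_forall {f g : ℕ → ℝ} (h : ∀ m, f m ≤ g m) :
    Hyperreal.ofSeq f ≤ Hyperreal.ofSeq g :=
  Hyperreal.ofSeq_le_ofSeq.2 (Eventually.of_forall h)

theorem mk_le_mk_of_le {x y : Hyperreal} (hx : 0 ≤ x) (h : x ≤ y) : ArchimedeanClass.mk y ≤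
    ArchimedeanClass.mk x :=
  mk_antitoneOn hx (hx.trans h) h

theorem exists_countable_field_of_definition {n : ℕ} (P : MvPolynomial (Fin n) ℝ) :
    ∃ F : IntermediateField ℚ ℝ, Cardinal.mk F ≤ Cardinal.aleph0 ∧
      ∃ P' : MvPolynomial (Fin n) F, MvPolynomial.map (algebraMap F ℝ) P' = P := by
  refine ⟨IntermediateField.adjoin ℚ (P.coeffs : Set ℝ), ?_, ?_⟩
  · refine (IntermediateField.cardinalMk_adjoin_le ℚ _).trans
      (max_le (max_le (Cardinal.mk_le_aleph0) ?_) le_rfl)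
    rw [Cardinal.le_aleph0_iff_set_countable]
    exact P.coeffs.countable_toSet
  · have : P ∈ Set.range (MvPolynomial.map (σ := Fin n)
        (algebraMap (IntermediateField.adjoin ℚ (P.coeffs : Set ℝ)) ℝ)) := by
      rw [MvPolynomial.mem_range_map_iff_coeffs_subset]
      intro a ha
      exact ⟨⟨a, IntermediateField.subset_adjoin _ _ ha⟩, rfl⟩
    exact this

/-- There is no sequence of points at which the gradient of `P` is smaller than every power
(with exponent below one) of the positive value of `P` as that value tends to zero. -/
theorem false_of_small_gradient {n : ℕ} (P : MvPolynomial (Fin n) ℝ) (x : ℕ → Fin n → ℝ) {D : ℝ}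
    (hD : ∀ m i, |x m i| ≤ D) (hpos : ∀ m, 0 < MvPolynomial.eval (x m) P)
    (hlim : Tendsto (fun m => MvPolynomial.eval (x m) P) atTop (𝓝 0))
    (hG : ∀ m, (∑ i, MvPolynomial.eval (x m) (MvPolynomial.pderiv i P) ^ 2) ^ (m + 1) <
      MvPolynomial.eval (x m) P ^ (2 * m)) : False := by
  obtain ⟨F, hF, P', hP'⟩ := exists_countable_field_of_definition P
  obtain ⟨c, hc⟩ := exists_algebraicIndependent_real hF n
  set τ : ℕ → ℝ := fun m => MvPolynomial.eval (x m) P with hτ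
  set q : ℕ → ℝ := fun m => (∑ i, MvPolynomial.eval (x m) (MvPolynomial.pderiv i P) ^ 2) / τ m ^ 2
    with hq
  set K : ℝ := ∑ i, (D + |c i|) ^ 2 with hK
  have hK0 : 0 ≤ K := by positivity
  set r : ℕ → ℝ := fun m => max (q m) 1 with hr
  have hB : ∀ m, ∑ j, MvPolynomial.eval (x m) (MvPolynomial.pderiv j P) ^ 2 +
      τ m ^ 2 * ∑ j, (x m j - c j) ^ 2 ≤ τ m ^ 2 * ((1 + K) * r m) := by
    intro m
    have h1 : ∑ j, (x m j - c j) ^ 2 ≤ K := by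
      refine Finset.sum_le_sum fun j _ => ?_
      rw [← sq_abs]
      have : |x m j - c j| ≤ D + |c j| := (abs_sub _ _).trans (by gcongr; exact hD m j)
      gcongr
    have h2 : ∑ j, MvPolynomial.eval (x m) (MvPolynomial.pderiv j P) ^ 2 = τ m ^ 2 * q m := by
      rw [hq, mul_div_cancel₀ _ (pow_ne_zero 2 (hpos m).ne')]
    rw [h2, ← mul_add]
    have h3 : q m ≤ r m := le_max_left _ _
    have h4 : 1 ≤ r m := le_max_right _ _
    gcongr
    nlinarith
  have hex :=
      fun m => MvPolynomialCalculus.exists_penalty_critical P c (x m) (hpos m).ne' rfl (hB m)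
  choose y hy1 hy2 hy3 hy4 using hex
  set t : Hyperreal := Hyperreal.ofSeq τ with ht
  have htpos : 0 < t := Hyperreal.ofSeq_lt_ofSeq.2 (Eventually.of_forall hpos)
  have ht0 : t ≠ 0 := htpos.ne'
  have htmk : 0 < ArchimedeanClass.mk t := Hyperreal.archimedeanClassMk_pos_of_tendsto
    (Hyperreal.tendsto_ofSeq.2 (hlim.mono_left Nat.hyperfilter_le_atTop))
  set R : Hyperreal := Hyperreal.ofSeq r with hR
  have hR1 : 1 ≤ R := ofSeq_le_of_forall fun m => le_max_right _ _
  have hRk : ∀ k : ℕ, 0 < ArchimedeanClass.mk (R ^ k * t) := by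
    intro k
    have h1 : (R ^ k * t) ^ 4 ≤ t ^ 2 := by
      have : ∀ᶠ m in (hyperfilter ℕ : Filter ℕ), (r m ^ k * τ m) ^ 4 ≤ τ m ^ 2 := by
        refine (Nat.hyperfilter_le_atTop ?_ :)
        have hlt : ∀ᶠ m in atTop, τ m < 1 := hlim.eventually (gt_mem_nhds one_pos)
        filter_upwards [hlt, eventually_ge_atTop (4 * k)] with m hm1 hmk
        have hr1 : 1 ≤ r m := le_max_right _ _
        have hτ0 := hpos m
        change 0 < τ m at hτ0
        have hτ2 : τ m ^ 2 ≤ 1 := pow_le_one₀ hτ0.le hm1.le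
        have h2 : r m ^ (m + 1) * τ m ^ 2 ≤ 1 := by
          rcases le_total (q m) 1 with h | h
          · simp only [hr, max_eq_right h, one_pow, one_mul, hτ2]
          · have hrq : r m = q m := max_eq_left h
            rw [hrq]
            simp only [hq, div_pow]
            rw [div_mul_eq_mul_div, div_le_one (by positivity)]
            calc _ ≤ τ m ^ (2 * m) * τ m ^ 2 := by gcongr; exact (hG m).le
              _ = _ := by ring
        have h3 : r m ^ (4 * k) ≤ r m ^ (m + 1) := pow_le_pow_right₀ hr1 (by omega)
        calc (r m ^ k * τ m) ^ 4 = (r m ^ (4 * k) * τ m ^ 2) * τ m ^ 2 := by ring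
          _ ≤ (r m ^ (m + 1) * τ m ^ 2) * τ m ^ 2 := by gcongr
          _ ≤ 1 * τ m ^ 2 := by gcongr
          _ = τ m ^ 2 := one_mul _
      exact Hyperreal.ofSeq_le_ofSeq.2 this
    have h2 : ArchimedeanClass.mk (t ^ 2) ≤ ArchimedeanClass.mk ((R ^ k * t) ^ 4) :=
      mk_le_mk_of_le (by positivity) h1
    rw [mk_pow, mk_pow] at h2
    by_contra! hneg
    have h3 : 4 • ArchimedeanClass.mk (R ^ k * t) ≤ 0 := nsmul_nonpos hneg 4
    have h4 : 0 < 2 • ArchimedeanClass.mk t := by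
      rw [two_nsmul]
      exact add_pos_of_pos_of_nonneg htmk htmk.le
    exact absurd (h2.trans h3) (not_le.2 h4)
  have hbound : ∀ (z : Hyperreal), z ^ 2 ≤ algebraMap ℝ Hyperreal (1 + K) * R →
      ∀ k : ℕ, 0 < ArchimedeanClass.mk (z ^ k * t) := by
    intro z hz k
    have h1 : ArchimedeanClass.mk R ≤ ArchimedeanClass.mk (z ^ 2) := by
      have := mk_le_mk_of_le (sq_nonneg z) hz
      rwa [mk_mul, mk_algebraMap (by positivity), zero_add] at this
    have h2 : 0 < ArchimedeanClass.mk ((z ^ k * t) ^ 2) := by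
      have h3 : ArchimedeanClass.mk ((z ^ k * t) ^ 2) =
          k • ArchimedeanClass.mk (z ^ 2) + ArchimedeanClass.mk t + ArchimedeanClass.mk t := by
        rw [show (z ^ k * t) ^ 2 = (z ^ 2) ^ k * t * t by ring, mk_mul, mk_mul, mk_pow]
      have h4 : k • ArchimedeanClass.mk R + ArchimedeanClass.mk t + ArchimedeanClass.mk t ≤
          k • ArchimedeanClass.mk (z ^ 2) + ArchimedeanClass.mk t + ArchimedeanClass.mk t := by
        gcongr
      have h5 : 0 < k • ArchimedeanClass.mk R + ArchimedeanClass.mk t := by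
        have := hRk k
        rwa [mk_mul, mk_pow] at this
      rw [h3]
      exact (add_pos_of_pos_of_nonneg h5 htmk.le).trans_le h4
    by_contra! hneg
    rw [mk_pow] at h2
    exact absurd (nsmul_nonpos hneg 2) (not_le.2 h2)
  set Y : Fin n → Hyperreal := fun i => Hyperreal.ofSeq fun m => y m i with hY
  have hev : ∀ Q : MvPolynomial (Fin n) ℝ, MvPolynomial.aeval Y Q =
    Hyperreal.ofSeq fun m => MvPolynomial.eval (y m) Q := aeval_ofSeq y
  have hcrit : ∀ i, t ^ 4 * algebraMap ℝ Hyperreal (c i) = t ^ 4 * Y i +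
      t ^ 2 * MvPolynomial.aeval Y
        (∑ j, MvPolynomial.pderiv j P * MvPolynomial.pderiv i (MvPolynomial.pderiv j P)) +
      (MvPolynomial.aeval Y P - t) * MvPolynomial.aeval Y (MvPolynomial.pderiv i P) := by
    intro i
    rw [hev, hev, hev]
    refine congrArg Hyperreal.ofSeq (funext fun m => ?_ :
      (fun m => τ m ^ 4 * c i) = fun m => τ m ^ 4 * y m i + τ m ^ 2 * MvPolynomial.eval (y m)
        (∑ j, MvPolynomial.pderiv j P * MvPolynomial.pderiv i (MvPolynomial.pderiv j P)) +
        (MvPolynomial.eval (y m) P - τ m) * MvPolynomial.eval (y m) (MvPolynomial.pderiv i P))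
    simp only [map_sum, map_mul]
    exact hy1 m i
  have hmem : ∀ Q' : MvPolynomial (Fin n) F,
      MvPolynomial.aeval Y (MvPolynomial.map (algebraMap F ℝ) Q') ∈
        Algebra.adjoin F (insert t (Set.range Y)) := by
    intro Q'
    rw [MvPolynomial.aeval_map_algebraMap]
    have h1 : MvPolynomial.aeval Y Q' ∈ Algebra.adjoin F (Set.range Y) := by
      rw [Algebra.adjoin_range_eq_range_aeval]
      exact ⟨Q', rfl⟩
    exact Algebra.adjoin_mono (Set.subset_insert _ _) h1
  have htA : t ∈ Algebra.adjoin F (insert t (Set.range Y)) :=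
    Algebra.subset_adjoin (Set.mem_insert _ _)
  have hfin := finiteDimensional_adjoin_of_algebraicIndependent hc
    (transcendental_of_infinitesimal htmk ht0) Y 4 (by
      intro i
      rw [hcrit, ← hP']
      simp only [MvPolynomial.pderiv_map, ← map_mul, ← map_sum (MvPolynomial.map (algebraMap F ℝ))]
      exact add_mem (add_mem (mul_mem (pow_mem htA 4) (Algebra.subset_adjoin
        (Set.mem_insert_of_mem _ ⟨i, rfl⟩))) (mul_mem (pow_mem htA 2) (hmem _)))
        (mul_mem (sub_mem (hmem _) htA) (hmem _)))
  set E := IntermediateField.adjoin ℝ⟮t⟯ (Set.range Y) with hE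
  have hYE : ∀ i, Y i ∈ E := fun i => IntermediateField.subset_adjoin _ _ ⟨i, rfl⟩
  have halgE : ∀ a : ℝ, algebraMap ℝ Hyperreal a ∈ E :=
      fun a => E.algebraMap_mem (algebraMap ℝ ℝ⟮t⟯ a)
  have htE : t ∈ E := E.algebraMap_mem ⟨t, IntermediateField.mem_adjoin_simple_self ℝ t⟩
  have hevE : ∀ Q : MvPolynomial (Fin n) ℝ, MvPolynomial.aeval Y Q ∈ E := by
    intro Q
    induction Q using MvPolynomial.induction_on with
    | C a => simpa using halgE a
    | add p q hp hq => rw [map_add]; exact add_mem hp hq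
    | mul_X p i hp => rw [map_mul, MvPolynomial.aeval_X]; exact mul_mem hp (hYE i)
  have hfinE : ∀ z ∈ E, z ^ 2 ≤ algebraMap ℝ Hyperreal (1 + K) * R → 0 ≤ ArchimedeanClass.mk z :=
      fun z hz h =>
    mk_nonneg_of_pow_mul htmk ht0 E hz (hbound z h)
  have hYfin : ∀ i, 0 ≤ ArchimedeanClass.mk (Y i) := by
    intro i
    have h1 : 0 ≤ ArchimedeanClass.mk (Y i - algebraMap ℝ Hyperreal (c i)) :=
      hfinE _ (sub_mem (hYE i) (halgE _)) (ofSeq_le_of_forall fun m => hy4 m i)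
    rw [← sub_add_cancel (Y i) (algebraMap ℝ Hyperreal (c i))]
    exact (le_min h1 (mk_algebraMap_nonneg _)).trans (min_le_mk_add _ _)
  have hgrad : ∀ i, ArchimedeanClass.mk t ≤
      ArchimedeanClass.mk (MvPolynomial.aeval Y (MvPolynomial.pderiv i P)) := by
    intro i
    have h1 : 0 ≤ ArchimedeanClass.mk (MvPolynomial.aeval Y (MvPolynomial.pderiv i P) / t) := by
      refine hfinE _ (div_mem (hevE _) htE) ?_
      rw [div_pow, div_le_iff₀ (by positivity), mul_comm _ (t ^ 2), hev]
      exact ofSeq_le_of_forall fun m => hy2 m i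
    rw [← mul_div_cancel₀ (MvPolynomial.aeval Y (MvPolynomial.pderiv i P)) ht0, mk_mul]
    exact le_add_of_nonneg_right h1
  have hval : ArchimedeanClass.mk (MvPolynomial.aeval Y P) = ArchimedeanClass.mk t := by
    have h1 : 0 ≤ ArchimedeanClass.mk ((MvPolynomial.aeval Y P - t) / t ^ 2) := by
      refine hfinE _ (div_mem (sub_mem (hevE _) htE) (pow_mem htE 2)) ?_
      rw [div_pow, div_le_iff₀ (by positivity), mul_comm _ ((t ^ 2) ^ 2), ← pow_mul, hev]
      exact ofSeq_le_of_forall fun m => hy3 m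
    have h2 : MvPolynomial.aeval Y P = t + t * (t * ((MvPolynomial.aeval Y P - t) / t ^ 2)) := by
      field_simp
      ring
    have h3 : ArchimedeanClass.mk t <
        ArchimedeanClass.mk (t * (t * ((MvPolynomial.aeval Y P - t) / t ^ 2))) := by
      rw [mk_mul, mk_mul]
      have h4 : 0 <
          ArchimedeanClass.mk t + ArchimedeanClass.mk ((MvPolynomial.aeval Y P - t) / t ^ 2) :=
              add_pos_of_pos_of_nonneg htmk h1
      refine lt_of_le_of_ne (le_add_of_nonneg_right h4.le) fun h => h4.ne ?_
      exact add_left_cancel_of_ne_top (mt mk_eq_top_iff.1 ht0) (by rw [add_zero, ← h])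
    rw [h2]
    exact mk_add_eq_mk_left h3
  exact false_of_mk_pderiv htmk ht0 E P Y hYE hYfin hval hgrad

end HyperrealCurve

namespace MvPolynomialCalculus
open Topology

theorem continuous_eval_pi {n : ℕ} (P : MvPolynomial (Fin n) ℝ) :
    Continuous fun x : Fin n → ℝ => MvPolynomial.eval x P :=
  MvPolynomial.continuous_eval P

theorem exists_pow_le_gradient_pow {n : ℕ} (P : MvPolynomial (Fin n) ℝ) (x₀ : Fin n → ℝ)
    (h₀ : MvPolynomial.eval x₀ P = 0) :
    ∃ (m : ℕ) (δ : ℝ), 0 < δ ∧ ∀ x, dist x x₀ < δ → 0 < MvPolynomial.eval x P →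
      MvPolynomial.eval x P ^ (2 * m) ≤
        (∑ i, MvPolynomial.eval x (MvPolynomial.pderiv i P) ^ 2) ^ (m + 1) := by
  by_contra! H
  choose x hx1 hx2 hx3 using fun m : ℕ => H m (1 / ((m : ℝ) + 1)) (by positivity)
  have hx : Tendsto x atTop (𝓝 x₀) := by
    rw [tendsto_iff_dist_tendsto_zero]
    exact squeeze_zero (fun _ => dist_nonneg) (fun m => (hx1 m).le)
      tendsto_one_div_add_atTop_nhds_zero_nat
  refine HyperrealCurve.false_of_small_gradient P x (D := ‖x₀‖ + 1) (fun m i => ?_) hx2 ?_ hx3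
  · have h1 : dist (x m) x₀ ≤ 1 := (hx1 m).le.trans (by
      rw [div_le_one (by positivity)]; linarith [Nat.cast_nonneg (α := ℝ) m])
    have h2 : ‖x m i‖ ≤ ‖x m‖ := norm_le_pi_norm _ _
    have h3 : ‖x m‖ ≤ ‖x₀‖ + ‖x m - x₀‖ := norm_le_insert' _ _
    rw [dist_eq_norm] at h1
    rw [Real.norm_eq_abs] at h2
    linarith
  · have := ((continuous_eval_pi P).tendsto x₀).comp hx
    rwa [h₀] at this

theorem rpow_le_of_pow_le {t G β : ℝ} {m : ℕ} (ht : 0 < t) (ht1 : t ≤ 1) (hG : 0 ≤ G)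
    (h : t ^ (2 * m) ≤ G ^ (m + 1)) (hβ : (m : ℝ) / (m + 1) ≤ β) : t ^ (2 * β) ≤ G := by
  have h1 : t ^ (2 * β) ≤ t ^ (2 * ((m : ℝ) / (m + 1))) :=
    Real.rpow_le_rpow_of_exponent_ge ht ht1 (by linarith)
  refine h1.trans ?_
  refine le_of_pow_le_pow_left₀ (n := m + 1) (by omega) hG ?_
  rw [← Real.rpow_natCast (t ^ _), ← Real.rpow_mul ht.le]
  have : 2 * ((m : ℝ) / (m + 1)) * ((m + 1 : ℕ) : ℝ) = ((2 * m : ℕ) : ℝ) := by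
    push_cast; field_simp
  rwa [this, Real.rpow_natCast]

/-- The gradient inequality of Łojasiewicz for real polynomials. -/
theorem exists_lojasiewicz {n : ℕ} (P : MvPolynomial (Fin n) ℝ) (x₀ : Fin n → ℝ) :
    ∃ (β₀ δ : ℝ), β₀ < 1 ∧ 0 < δ ∧ ∀ x, dist x x₀ < δ → ∀ β, 0 < β → β₀ ≤ β →
      |MvPolynomial.eval x P - MvPolynomial.eval x₀ P| ^ (2 * β) ≤
        ∑ i, MvPolynomial.eval x (MvPolynomial.pderiv i P) ^ 2 := by
  set c := MvPolynomial.eval x₀ P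
  obtain ⟨m₁, δ₁, hδ₁, h₁⟩ := exists_pow_le_gradient_pow (P - MvPolynomial.C c) x₀ (by simp [c])
  obtain ⟨m₂, δ₂, hδ₂, h₂⟩ := exists_pow_le_gradient_pow (MvPolynomial.C c - P) x₀ (by simp [c])
  obtain ⟨δ₃, hδ₃, h₃⟩ := Metric.continuous_iff.1 (continuous_eval_pi P) x₀ 1 one_pos
  have hlt : ∀ m : ℕ, (m : ℝ) / (m + 1) < 1 := fun m => by
    rw [div_lt_one (by positivity)]; linarith
  refine ⟨max ((m₁ : ℝ) / (m₁ + 1)) ((m₂ : ℝ) / (m₂ + 1)), min δ₁ (min δ₂ δ₃),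
    max_lt (hlt _) (hlt _), by positivity, fun x hx β hβ0 hβ => ?_⟩
  have hx1 := hx.trans_le (min_le_left _ _)
  have hx2 := hx.trans_le ((min_le_right _ _).trans (min_le_left _ _))
  have hx3 := h₃ x (hx.trans_le ((min_le_right _ _).trans (min_le_right _ _)))
  rw [Real.dist_eq] at hx3
  have hG : 0 ≤ ∑ i, MvPolynomial.eval x (MvPolynomial.pderiv i P) ^ 2 := by positivity
  rcases lt_trichotomy (MvPolynomial.eval x P - c) 0 with h | h | h
  · have h' := h₂ x hx2 (by simp; linarith)
    simp only [map_sub, MvPolynomial.eval_C, MvPolynomial.pderiv_C, zero_sub,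
      map_neg, neg_sq] at h'
    rw [abs_of_neg h, neg_sub]
    exact rpow_le_of_pow_le (by linarith) (by rw [abs_of_neg h] at hx3; linarith) hG h'
      ((le_max_right _ _).trans hβ)
  · rw [h, abs_zero, Real.zero_rpow (by positivity)]
    exact hG
  · have h' := h₁ x hx1 (by simp; linarith)
    simp only [map_sub, MvPolynomial.eval_C, MvPolynomial.pderiv_C, sub_zero] at h'
    rw [abs_of_pos h]
    exact rpow_le_of_pow_le h (by rw [abs_of_pos h] at hx3; linarith) hG h'
      ((le_max_left _ _).trans hβ)

end MvPolynomialCalculus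

/-- A function is piecewise polynomial with finitely many break points. -/
def HasFiniteBreaks (F : ℝ → ℝ) : Prop :=
  ∃ T : Finset ℝ, ∀ I : Set ℝ, I.OrdConnected → Disjoint I (T : Set ℝ) →
    ∃ q : Polynomial ℝ, ∀ x ∈ I, F x = q.eval x

namespace HasFiniteBreaks
open Topology

theorem of_piecewisePoly {F : ℝ → ℝ} (hF : PiecewisePoly F) : HasFiniteBreaks F := by
  classical
  obtain ⟨K, τ, -, h0, hK, -, hq⟩ := hF
  refine ⟨(Finset.range (K + 1)).image fun k => (τ k).toReal, fun I hI hT => ?_⟩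
  rcases I.eq_empty_or_nonempty with rfl | ⟨x₀, hx₀⟩
  · exact ⟨0, fun x hx => hx.elim⟩
  have hmem : ∀ k ≤ K, ∀ r ∈ I, τ k ≠ (r : EReal) := by
    intro k hk r hr h
    refine Set.disjoint_left.1 hT hr ?_
    simp only [Finset.coe_image, Set.mem_image, Finset.coe_range, Set.mem_Iio]
    exact ⟨k, by omega, by rw [h, EReal.toReal_coe]⟩
  have hex : ∃ k, (x₀ : EReal) < τ k := ⟨K, hK ▸ EReal.coe_lt_top x₀⟩
  have hle : Nat.find hex ≤ K := Nat.find_min' hex (hK ▸ EReal.coe_lt_top x₀)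
  obtain ⟨k, hk⟩ : ∃ k, Nat.find hex = k + 1 := Nat.exists_eq_succ_of_ne_zero fun h => by
    have := Nat.find_spec hex
    rw [h, h0] at this
    exact not_lt_bot this
  have hup : (x₀ : EReal) < τ (k + 1) := hk ▸ Nat.find_spec hex
  have hlo : τ k < (x₀ : EReal) :=
    lt_of_le_of_ne (not_lt.1 (Nat.find_min hex (m := k) (by omega))) (hmem k (by omega) _ hx₀)
  have hbetween : ∀ j ≤ K, ∀ x ∈ I, ∀ y ∈ I, ¬ ((x : EReal) ≤ τ j ∧ τ j ≤ (y : EReal)) := by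
    rintro j hj x hx y hy ⟨h1, h2⟩
    have hne1 : τ j ≠ ⊤ := fun h => by simp [h] at h2
    have hne2 : τ j ≠ ⊥ := fun h => by simp [h] at h1
    lift τ j to ℝ using ⟨hne1, hne2⟩ with r hr
    exact hmem j hj r (hI.out hx hy ⟨EReal.coe_le_coe_iff.1 h1, EReal.coe_le_coe_iff.1 h2⟩) hr.symm
  obtain ⟨q, hq⟩ := hq k (by omega)
  refine ⟨q, fun x hx => hq x ?_ ?_⟩
  · by_contra! h
    exact hbetween k (by omega) x hx x₀ hx₀ ⟨h, hlo.le⟩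
  · by_contra! h
    exact hbetween (k + 1) (by omega) x₀ hx₀ x hx ⟨hup.le, h⟩

theorem of_polynomial (q : Polynomial ℝ) : HasFiniteBreaks fun x => q.eval x :=
  ⟨∅, fun _ _ _ => ⟨q, fun _ _ => rfl⟩⟩

theorem of_abs : HasFiniteBreaks fun x => |x| := by
  refine ⟨{0}, fun I hI hT => ?_⟩
  simp only [Finset.coe_singleton, Set.disjoint_singleton_right] at hT
  by_cases h : ∃ x ∈ I, 0 < x
  · obtain ⟨x, hx, hx0⟩ := h
    refine ⟨Polynomial.X, fun y hy => ?_⟩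
    beta_reduce
    rw [Polynomial.eval_X, abs_of_pos]
    by_contra! hy0
    exact hT (hI.out hy hx ⟨hy0, hx0.le⟩)
  · push Not at h
    exact ⟨-Polynomial.X, fun y hy => by
      beta_reduce
      rw [Polynomial.eval_neg, Polynomial.eval_X, abs_of_nonpos (h y hy)]⟩

theorem binary {F G : ℝ → ℝ} (hF : HasFiniteBreaks F) (hG : HasFiniteBreaks G)
    (op : ℝ → ℝ → ℝ) (opP : Polynomial ℝ → Polynomial ℝ → Polynomial ℝ)
    (hop : ∀ p q x, (opP p q).eval x = op (p.eval x) (q.eval x)) :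
    HasFiniteBreaks fun x => op (F x) (G x) := by
  classical
  obtain ⟨T₁, h₁⟩ := hF
  obtain ⟨T₂, h₂⟩ := hG
  refine ⟨T₁ ∪ T₂, fun I hI hT => ?_⟩
  rw [Finset.coe_union, Set.disjoint_union_right] at hT
  obtain ⟨q₁, hq₁⟩ := h₁ I hI hT.1
  obtain ⟨q₂, hq₂⟩ := h₂ I hI hT.2
  exact ⟨opP q₁ q₂, fun x hx => by
    beta_reduce
    rw [hq₁ x hx, hq₂ x hx, hop]⟩

theorem add {F G : ℝ → ℝ} (hF : HasFiniteBreaks F) (hG : HasFiniteBreaks G) :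
    HasFiniteBreaks fun x => F x + G x :=
  binary hF hG (· + ·) (· + ·) fun _ _ _ => Polynomial.eval_add

theorem sub {F G : ℝ → ℝ} (hF : HasFiniteBreaks F) (hG : HasFiniteBreaks G) :
    HasFiniteBreaks fun x => F x - G x :=
  binary hF hG (· - ·) (· - ·) fun _ _ _ => Polynomial.eval_sub _ _ _

theorem mul {F G : ℝ → ℝ} (hF : HasFiniteBreaks F) (hG : HasFiniteBreaks G) :
    HasFiniteBreaks fun x => F x * G x :=
  binary hF hG (· * ·) (· * ·) fun _ _ _ => Polynomial.eval_mul

theorem _root_.Polynomial.exists_derivative_eq (q : Polynomial ℝ) :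
    ∃ Q : Polynomial ℝ, Q.derivative = q := by
  induction q using Polynomial.induction_on' with
  | add p q hp hq =>
    obtain ⟨P, rfl⟩ := hp
    obtain ⟨Q, rfl⟩ := hq
    exact ⟨P + Q, Polynomial.derivative_add⟩
  | monomial n a =>
    refine ⟨Polynomial.monomial (n + 1) (a / (n + 1)), ?_⟩
    rw [Polynomial.derivative_monomial]
    congr 1
    push_cast
    field_simp

theorem of_hasDerivAt {F G : ℝ → ℝ} (hG : HasFiniteBreaks G) (hF : ∀ x, HasDerivAt F (G x) x) :
    HasFiniteBreaks F := by
  obtain ⟨T, hT⟩ := hG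
  refine ⟨T, fun I hI hIT => ?_⟩
  obtain ⟨q, hq⟩ := hT I hI hIT
  obtain ⟨Q, hQ⟩ := q.exists_derivative_eq
  rcases I.eq_empty_or_nonempty with rfl | ⟨x₀, hx₀⟩
  · exact ⟨0, fun x hx => hx.elim⟩
  refine ⟨Q + Polynomial.C (F x₀ - Q.eval x₀), fun x hx => ?_⟩
  have h := Convex.norm_image_sub_le_of_norm_hasDerivWithin_le (f := fun y => F y - Q.eval y)
    (f' := fun y => G y - q.eval y) (s := I) (C := 0)
    (fun y _ => ((hF y).sub (hQ ▸ Q.hasDerivAt y)).hasDerivWithinAt)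
    (fun y hy => by rw [hq y hy, sub_self, norm_zero]) hI.convex hx₀ hx
  rw [zero_mul, norm_le_zero_iff] at h
  simp only [Polynomial.eval_add, Polynomial.eval_C]
  linarith

theorem exists_finset_eventuallyEq {F : ℝ → ℝ} (hF : HasFiniteBreaks F) :
    ∃ (T : Finset ℝ) (Q : Finset (Polynomial ℝ)), ∀ x ∉ T, ∃ q ∈ Q,
      F =ᶠ[𝓝 x] fun y => q.eval y := by
  classical
  obtain ⟨T, hT⟩ := hF
  set J : Finset ℝ → Set ℝ := fun S => ⋂ t ∈ T, if t ∈ S then Set.Ioi t else Set.Iio t with hJ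
  have hJmem : ∀ S x, x ∈ J S ↔ ∀ t ∈ T, if t ∈ S then t < x else x < t := by
    intro S x
    simp only [hJ, Set.mem_iInter]
    refine forall₂_congr fun t _ => ?_
    split_ifs <;> rfl
  have hJo : ∀ S, IsOpen (J S) := fun S => isOpen_biInter_finset fun t _ => by
    split_ifs
    exacts [isOpen_Ioi, isOpen_Iio]
  have hJc : ∀ S, (J S).OrdConnected := fun S => Set.ordConnected_biInter fun t _ => by
    split_ifs
    exacts [Set.ordConnected_Ioi, Set.ordConnected_Iio]
  have hJd : ∀ S, Disjoint (J S) (T : Set ℝ) := fun S => Set.disjoint_left.2 fun x hx hxT => by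
    have := (hJmem S x).1 hx x hxT
    split_ifs at this <;> exact lt_irrefl _ this
  choose q hq using fun S => hT (J S) (hJc S) (hJd S)
  refine ⟨T, T.powerset.image q, fun x hx => ⟨q (T.filter (· < x)),
    Finset.mem_image_of_mem _ (Finset.mem_powerset.2 (Finset.filter_subset _ _)), ?_⟩⟩
  have hxJ : x ∈ J (T.filter (· < x)) := by
    rw [hJmem]
    intro t ht
    split_ifs with h
    · exact (Finset.mem_filter.1 h).2
    · refine lt_of_le_of_ne (not_lt.1 fun h' => h (Finset.mem_filter.2 ⟨ht, h'⟩)) ?_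
      rintro rfl
      exact hx ht
  filter_upwards [(hJo _).mem_nhds hxJ] with y hy
  exact hq _ y hy

end HasFiniteBreaks

theorem MvPolynomial.dense_eval_ne_zero {n : ℕ} {P : MvPolynomial (Fin n) ℝ} (hP : P ≠ 0) :
    Dense {x : Fin n → ℝ | MvPolynomial.eval x P ≠ 0} := by
  intro x
  rw [mem_closure_iff_nhds]
  intro U hU
  by_contra hempty
  obtain ⟨ε, hε, hball⟩ := Metric.mem_nhds_iff.1 hU
  refine hP (MvPolynomial.funext_set (fun i => Metric.ball (x i) ε) (fun i => ?_) fun y hy => ?_)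
  · rw [Real.ball_eq_Ioo]
    exact Set.Ioo_infinite (by linarith)
  · rw [← ball_pi _ hε] at hy
    by_contra h
    exact hempty ⟨y, hball hy, by simpa using h⟩

/-- A function which agrees, near every point of a dense set, with one of finitely many
polynomials. -/
def GenericallyPolynomial {n : ℕ} (g : (Fin n → ℝ) → ℝ) : Prop :=
  ∃ S : Finset (MvPolynomial (Fin n) ℝ),
    Dense {θ | ∃ P ∈ S, ∀ᶠ z in nhds θ, g z = MvPolynomial.eval z P}

namespace GenericallyPolynomial
open Topology
variable {n : ℕ}

theorem isOpen_setOf (g : (Fin n → ℝ) → ℝ) (S : Finset (MvPolynomial (Fin n) ℝ)) :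
    IsOpen {θ | ∃ P ∈ S, ∀ᶠ z in 𝓝 θ, g z = MvPolynomial.eval z P} := by
  rw [isOpen_iff_mem_nhds]
  rintro θ ⟨P, hP, h⟩
  filter_upwards [eventually_eventually_nhds.2 h] with z hz using ⟨P, hP, hz⟩

theorem of_eval (P : MvPolynomial (Fin n) ℝ) :
    GenericallyPolynomial fun z => MvPolynomial.eval z P :=
  ⟨{P}, by simp⟩

theorem const (c : ℝ) : GenericallyPolynomial fun _ : Fin n → ℝ => c := by
  simpa using of_eval (MvPolynomial.C c)

theorem coord (i : Fin n) : GenericallyPolynomial fun z : Fin n → ℝ => z i := by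
  simpa using of_eval (MvPolynomial.X i)

theorem binary {g₁ g₂ : (Fin n → ℝ) → ℝ} (h₁ : GenericallyPolynomial g₁)
    (h₂ : GenericallyPolynomial g₂) (op : ℝ → ℝ → ℝ)
    (opP : MvPolynomial (Fin n) ℝ → MvPolynomial (Fin n) ℝ → MvPolynomial (Fin n) ℝ)
    (hop : ∀ P Q z, MvPolynomial.eval z (opP P Q) =
      op (MvPolynomial.eval z P) (MvPolynomial.eval z Q)) :
    GenericallyPolynomial fun z => op (g₁ z) (g₂ z) := by
  classical
  obtain ⟨S₁, hd₁⟩ := h₁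
  obtain ⟨S₂, hd₂⟩ := h₂
  refine ⟨Finset.image₂ opP S₁ S₂,
    (hd₁.inter_of_isOpen_left hd₂ (isOpen_setOf g₁ S₁)).mono ?_⟩
  rintro θ ⟨⟨P, hP, h1⟩, Q, hQ, h2⟩
  refine ⟨opP P Q, Finset.mem_image₂_of_mem hP hQ, ?_⟩
  filter_upwards [h1, h2] with z hz1 hz2
  rw [hz1, hz2, hop]

theorem add {g₁ g₂ : (Fin n → ℝ) → ℝ} (h₁ : GenericallyPolynomial g₁)
    (h₂ : GenericallyPolynomial g₂) : GenericallyPolynomial fun z => g₁ z + g₂ z :=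
  binary h₁ h₂ (· + ·) (· + ·) fun P Q z => map_add (MvPolynomial.eval z) P Q

theorem sub {g₁ g₂ : (Fin n → ℝ) → ℝ} (h₁ : GenericallyPolynomial g₁)
    (h₂ : GenericallyPolynomial g₂) : GenericallyPolynomial fun z => g₁ z - g₂ z :=
  binary h₁ h₂ (· - ·) (· - ·) fun P Q z => map_sub (MvPolynomial.eval z) P Q

theorem mul {g₁ g₂ : (Fin n → ℝ) → ℝ} (h₁ : GenericallyPolynomial g₁)
    (h₂ : GenericallyPolynomial g₂) : GenericallyPolynomial fun z => g₁ z * g₂ z :=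
  binary h₁ h₂ (· * ·) (· * ·) fun P Q z => map_mul (MvPolynomial.eval z) P Q

theorem sum {ι : Type*} (s : Finset ι) {g : ι → (Fin n → ℝ) → ℝ}
    (h : ∀ i ∈ s, GenericallyPolynomial (g i)) :
    GenericallyPolynomial fun z => ∑ i ∈ s, g i z := by
  classical
  induction s using Finset.induction_on with
  | empty => simpa using const 0
  | insert a s ha ih =>
    simp only [Finset.sum_insert ha]
    exact (h a (Finset.mem_insert_self a s)).add
      (ih fun i hi => h i (Finset.mem_insert_of_mem hi))

theorem comp {F : ℝ → ℝ} (hF : HasFiniteBreaks F) {g : (Fin n → ℝ) → ℝ}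
    (hg : GenericallyPolynomial g) : GenericallyPolynomial fun z => F (g z) := by
  classical
  obtain ⟨T, Q, hQ⟩ := hF.exists_finset_eventuallyEq
  obtain ⟨S, hd⟩ := hg
  refine ⟨Finset.image₂ (fun (q : Polynomial ℝ) P => Polynomial.aeval P q) Q S ∪
    T.image fun t => MvPolynomial.C (F t), ?_⟩
  rw [← dense_closure]
  refine hd.mono ?_
  rintro θ ⟨P, hP, hgP⟩
  by_cases hT : ∃ t ∈ T, P = MvPolynomial.C t
  · obtain ⟨t, ht, rfl⟩ := hT
    refine subset_closure ⟨MvPolynomial.C (F t),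
      Finset.mem_union_right _ (Finset.mem_image_of_mem _ ht), ?_⟩
    filter_upwards [hgP] with z hz
    rw [hz, MvPolynomial.eval_C, MvPolynomial.eval_C]
  · push Not at hT
    have hne : ∏ t ∈ T, (P - MvPolynomial.C t) ≠ 0 :=
      Finset.prod_ne_zero_iff.2 fun t ht => sub_ne_zero.2 (hT t ht)
    rw [mem_closure_iff_nhds]
    intro U hU
    obtain ⟨z, ⟨hzU, hzP⟩, hz⟩ := mem_closure_iff_nhds.1 (MvPolynomial.dense_eval_ne_zero hne θ)
      _ (inter_mem hU (eventually_eventually_nhds.2 hgP))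
    refine ⟨z, hzU, ?_⟩
    change MvPolynomial.eval z (∏ t ∈ T, (P - MvPolynomial.C t)) ≠ 0 at hz
    rw [map_prod, Finset.prod_ne_zero_iff] at hz
    have hzT : MvPolynomial.eval z P ∉ T := fun hmem => hz _ hmem (by simp)
    obtain ⟨q, hqQ, hq⟩ := hQ _ hzT
    refine ⟨Polynomial.aeval P q,
      Finset.mem_union_left _ (Finset.mem_image₂_of_mem hqQ hP), ?_⟩
    have hc : Tendsto (fun y => MvPolynomial.eval y P) (𝓝 z) (𝓝 (MvPolynomial.eval z P)) :=
      (MvPolynomial.continuous_eval P).tendsto z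
    filter_upwards [hzP, hc.eventually hq] with y hy1 hy2
    rw [hy1, hy2]
    have h := Polynomial.hom_eval₂ q (algebraMap ℝ (MvPolynomial (Fin n) ℝ))
      (MvPolynomial.eval y) P
    rw [Polynomial.aeval_def, h]
    have hid : (MvPolynomial.eval y).comp (algebraMap ℝ (MvPolynomial (Fin n) ℝ)) =
      RingHom.id ℝ := RingHom.ext fun r => by simp [MvPolynomial.algebraMap_eq]
    rw [hid]
    rfl

theorem exists_finset_forall {L : (Fin n → ℝ) → ℝ} (hL : GenericallyPolynomial L)
    {G : (Fin n → ℝ) → Fin n → ℝ} (hG : Continuous G)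
    (hd : ∀ θ, HasFDerivAt L (∑ i, G θ i • ContinuousLinearMap.proj (R := ℝ)
      (φ := fun _ : Fin n => ℝ) i) θ) :
    ∃ S : Finset (MvPolynomial (Fin n) ℝ), ∀ θ, ∃ P ∈ S, L θ = MvPolynomial.eval θ P ∧
      ∀ i, G θ i = MvPolynomial.eval θ (MvPolynomial.pderiv i P) := by
  obtain ⟨S, hdense⟩ := hL
  refine ⟨S, fun θ => ?_⟩
  have hcl : IsClosed {θ | ∃ P ∈ S, L θ = MvPolynomial.eval θ P ∧
      ∀ i, G θ i = MvPolynomial.eval θ (MvPolynomial.pderiv i P)} := by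
    have : {θ | ∃ P ∈ S, L θ = MvPolynomial.eval θ P ∧
      ∀ i, G θ i = MvPolynomial.eval θ (MvPolynomial.pderiv i P)} =
      ⋃ P ∈ S, {θ | L θ = MvPolynomial.eval θ P ∧
        ∀ i, G θ i = MvPolynomial.eval θ (MvPolynomial.pderiv i P)} := by
      ext
      simp only [Set.mem_ofPred_eq, Set.mem_iUnion, exists_prop]
    rw [this]
    refine isClosed_biUnion_finset fun P _ => ?_
    have h1 : IsClosed {θ | L θ = MvPolynomial.eval θ P} :=
      isClosed_eq (continuous_iff_continuousAt.2 fun θ => (hd θ).continuousAt)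
        (MvPolynomial.continuous_eval P)
    have h2 : IsClosed {θ | ∀ i, G θ i = MvPolynomial.eval θ (MvPolynomial.pderiv i P)} := by
      rw [Set.ofPred_forall]
      exact isClosed_iInter fun i => isClosed_eq ((continuous_apply i).comp hG)
        (MvPolynomial.continuous_eval _)
    exact h1.inter h2
  refine hcl.closure_subset_iff.2 ?_ (hdense θ)
  rintro x ⟨P, hP, hx⟩
  refine ⟨P, hP, hx.self_of_nhds, fun i => ?_⟩
  have h := (hd x).unique
    ((MvPolynomialCalculus.hasFDerivAt_eval P x).congr_of_eventuallyEq hx)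
  have h' := DFunLike.congr_fun h (Pi.single i 1)
  simpa [sum_apply, Pi.single_apply] using h'

/-- The gradient inequality of Łojasiewicz for continuously differentiable functions that are
generically piecewise polynomial. -/
theorem exists_lojasiewicz {L : (Fin n → ℝ) → ℝ} (hL : GenericallyPolynomial L)
    {G : (Fin n → ℝ) → Fin n → ℝ} (hG : Continuous G)
    (hd : ∀ θ, HasFDerivAt L (∑ i, G θ i • ContinuousLinearMap.proj (R := ℝ)
      (φ := fun _ : Fin n => ℝ) i) θ) (x₀ : Fin n → ℝ) :
    ∃ (β₀ δ : ℝ), β₀ < 1 ∧ 0 < δ ∧ ∀ x, dist x x₀ < δ → ∀ β, 0 < β → β₀ ≤ β →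
      |L x - L x₀| ^ (2 * β) ≤ ∑ i, G x i ^ 2 := by
  obtain ⟨S, hS⟩ := hL.exists_finset_forall hG hd
  have hLc : Continuous L := continuous_iff_continuousAt.2 fun θ => (hd θ).continuousAt
  have key : ∀ P : MvPolynomial (Fin n) ℝ, ∃ (β₀ δ : ℝ), β₀ < 1 ∧ 0 < δ ∧ ∀ x, dist x x₀ < δ →
      L x = MvPolynomial.eval x P → L x₀ = MvPolynomial.eval x₀ P ∧
      ∀ β, 0 < β → β₀ ≤ β → |MvPolynomial.eval x P - MvPolynomial.eval x₀ P| ^ (2 * β) ≤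
        ∑ i, MvPolynomial.eval x (MvPolynomial.pderiv i P) ^ 2 := by
    intro P
    by_cases h : L x₀ = MvPolynomial.eval x₀ P
    · obtain ⟨β₀, δ, h1, h2, h3⟩ := MvPolynomialCalculus.exists_lojasiewicz P x₀
      exact ⟨β₀, δ, h1, h2, fun x hx _ => ⟨h, h3 x hx⟩⟩
    · have hev := ((hLc.sub (MvPolynomial.continuous_eval P)).continuousAt
          (x := x₀)).eventually_ne (sub_ne_zero.2 h)
      obtain ⟨δ, hδ, hball⟩ := Metric.eventually_nhds_iff.1 hev
      exact ⟨0, δ, one_pos, hδ, fun x hx hxe => absurd (sub_eq_zero.2 hxe) (hball hx)⟩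
  choose B d hB hdp hkey using key
  obtain ⟨β₀, hβ1, hβ⟩ : ∃ β₀ < 1, ∀ P ∈ S, B P ≤ β₀ := by
    have h : ∀ᶠ β in 𝓝[<] (1 : ℝ), ∀ P ∈ S, B P ≤ β :=
      (Finset.eventually_all S).2 fun P _ =>
        (nhdsWithin_le_nhds (eventually_ge_nhds (hB P)) :)
    obtain ⟨β, h1, h2⟩ := (h.and self_mem_nhdsWithin).exists
    exact ⟨β, h2, h1⟩
  obtain ⟨δ, hδ0, hδ⟩ : ∃ δ > 0, ∀ P ∈ S, δ ≤ d P := by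
    have h : ∀ᶠ δ in 𝓝[>] (0 : ℝ), ∀ P ∈ S, δ ≤ d P :=
      (Finset.eventually_all S).2 fun P _ =>
        (nhdsWithin_le_nhds (eventually_le_nhds (hdp P)) :)
    obtain ⟨δ, h1, h2⟩ := (h.and self_mem_nhdsWithin).exists
    exact ⟨δ, h2, h1⟩
  refine ⟨β₀, δ, hβ1, hδ0, fun x hx β hβ0 hββ => ?_⟩
  obtain ⟨P, hP, h1, h2⟩ := hS x
  obtain ⟨h3, h4⟩ := hkey P x (hx.trans_le (hδ P hP)) h1
  rw [h1, h3]
  simp only [h2]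
  exact h4 β hβ0 ((hβ P hP).trans hββ)

end GenericallyPolynomial

theorem Continuous.integrableOn_Ioo_real {g : ℝ → ℝ} (hg : Continuous g) (a b : ℝ) :
    IntegrableOn g (Set.Ioo a b) :=
  hg.integrableOn_Icc.mono_set Set.Ioo_subset_Icc_self

namespace HasFiniteBreaks

theorem integral_left {ρ : ℝ → ℝ} (hc : Continuous ρ) (hρ : HasFiniteBreaks ρ) (b : ℝ) :
    HasFiniteBreaks fun m => ∫ x in m..b, ρ x := by
  have h0 : HasFiniteBreaks fun x => 0 - ρ x := by
    simpa using (of_polynomial 0).sub hρ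
  refine h0.of_hasDerivAt fun m => ?_
  rw [zero_sub]
  simp_rw [intervalIntegral.integral_symm b]
  exact (hc.integral_hasStrictDerivAt b m).hasDerivAt.neg

theorem integral_relu_pow_eq {ρ : ℝ → ℝ} {a b : ℝ} (h0 : ∀ x ∉ Set.Ioo a b, ρ x = 0) {j : ℕ}
    (hj : j ≠ 0) (m : ℝ) :
    ∫ x in Set.Ioo a b, max (x - m) 0 ^ j * ρ x = ∫ x in m..b, (x - m) ^ j * ρ x := by
  rw [setIntegral_eq_integral_of_forall_compl_eq_zero fun x hx => by rw [h0 x hx, mul_zero]]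
  rcases le_total m b with hmb | hmb
  · rw [intervalIntegral.integral_of_le hmb,
      ← setIntegral_eq_integral_of_forall_compl_eq_zero (s := Set.Ioc m b)]
    · refine setIntegral_congr_fun measurableSet_Ioc fun x hx => ?_
      rw [max_eq_left (sub_nonneg.2 hx.1.le)]
    · intro x hx
      by_cases hxm : x ≤ m
      · rw [max_eq_right (sub_nonpos.2 hxm), zero_pow hj, zero_mul]
      · rw [h0 x fun h => hx ⟨not_le.1 hxm, h.2.le⟩, mul_zero]
  · have h1 : ∫ x in m..b, (x - m) ^ j * ρ x = ∫ x in m..b, (0 : ℝ) := by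
      refine intervalIntegral.integral_congr fun x hx => ?_
      rw [Set.uIcc_of_ge hmb] at hx
      rw [h0 x fun h => not_lt.2 hx.1 h.2, mul_zero]
    rw [h1, intervalIntegral.integral_zero]
    refine integral_eq_zero_of_ae (Eventually.of_forall fun x => ?_)
    change max (x - m) 0 ^ j * ρ x = 0
    by_cases hxm : x ≤ m
    · rw [max_eq_right (sub_nonpos.2 hxm), zero_pow hj, zero_mul]
    · rw [h0 x fun h => not_lt.2 (hmb.trans (not_le.1 hxm).le) h.2, mul_zero]

theorem integral_relu {ρ : ℝ → ℝ} {a b : ℝ} (h0 : ∀ x ∉ Set.Ioo a b, ρ x = 0)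
    (hc : Continuous ρ) (hρ : HasFiniteBreaks ρ) :
    HasFiniteBreaks fun m => ∫ x in Set.Ioo a b, max (x - m) 0 * ρ x := by
  have hX : HasFiniteBreaks fun x => x := by simpa using of_polynomial Polynomial.X
  have h : ∀ m, ∫ x in Set.Ioo a b, max (x - m) 0 * ρ x =
      (∫ x in m..b, x * ρ x) - m * ∫ x in m..b, ρ x := by
    intro m
    have := integral_relu_pow_eq h0 one_ne_zero m
    simp only [pow_one] at this
    rw [this, ← intervalIntegral.integral_const_mul, ← intervalIntegral.integral_sub]
    · simp only [sub_mul]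
    · exact (continuous_id.mul hc).intervalIntegrable _ _
    · exact (continuous_const.mul hc).intervalIntegrable _ _
  simp only [h]
  exact ((hX.mul hρ).integral_left (continuous_id.mul hc) b).sub (hX.mul (hρ.integral_left hc b))

theorem integral_relu_sq {ρ : ℝ → ℝ} {a b : ℝ} (h0 : ∀ x ∉ Set.Ioo a b, ρ x = 0)
    (hc : Continuous ρ) (hρ : HasFiniteBreaks ρ) :
    HasFiniteBreaks fun m => ∫ x in Set.Ioo a b, max (x - m) 0 ^ 2 * ρ x := by
  have hX : HasFiniteBreaks fun x => x := by simpa using of_polynomial Polynomial.X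
  have h2X : HasFiniteBreaks fun x => 2 * x := by
    have := hX.add hX
    simpa only [two_mul] using this
  have h : ∀ m, ∫ x in Set.Ioo a b, max (x - m) 0 ^ 2 * ρ x =
      (∫ x in m..b, x * x * ρ x) - 2 * m * (∫ x in m..b, x * ρ x) +
        m * m * ∫ x in m..b, ρ x := by
    intro m
    rw [integral_relu_pow_eq h0 two_ne_zero m, ← intervalIntegral.integral_const_mul,
      ← intervalIntegral.integral_const_mul, ← intervalIntegral.integral_sub,
      ← intervalIntegral.integral_add]
    · congr 1
      funext x
      ring
    all_goals exact Continuous.intervalIntegrable (by fun_prop) _ _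
  simp only [h]
  exact ((((hX.mul hX).mul hρ).integral_left (by fun_prop) b).sub
    (h2X.mul ((hX.mul hρ).integral_left (by fun_prop) b))).add
    ((hX.mul hX).mul (hρ.integral_left hc b))

end HasFiniteBreaks

namespace GenericallyPolynomial
variable {n : ℕ}

theorem relu_mul_relu (x s t : ℝ) : max (x - s) 0 * max (x - t) 0 =
    max (x - max s t) 0 ^ 2 + |s - t| * max (x - max s t) 0 := by
  rcases le_total s t with h | h
  · rw [max_eq_right h, abs_of_nonpos (sub_nonpos.2 h)]
    rcases le_total x t with hx | hx
    · rw [max_eq_right (sub_nonpos.2 hx)]; ring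
    · rw [max_eq_left (sub_nonneg.2 hx), max_eq_left (by linarith)]; ring
  · rw [max_eq_left h, abs_of_nonneg (sub_nonneg.2 h)]
    rcases le_total x s with hx | hx
    · rw [max_eq_right (sub_nonpos.2 hx)]; ring
    · rw [max_eq_left (sub_nonneg.2 hx), max_eq_left (by linarith)]; ring

theorem of_max {g₁ g₂ : (Fin n → ℝ) → ℝ} (h₁ : GenericallyPolynomial g₁)
    (h₂ : GenericallyPolynomial g₂) : GenericallyPolynomial fun z => max (g₁ z) (g₂ z) := by
  have h : ∀ s t : ℝ, max s t = (s + t + |t - s|) * 2⁻¹ := fun s t => by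
    rcases le_total s t with hst | hst
    · rw [max_eq_right hst, abs_of_nonneg (sub_nonneg.2 hst)]; ring
    · rw [max_eq_left hst, abs_of_nonpos (sub_nonpos.2 hst)]; ring
  simp only [h]
  exact ((h₁.add h₂).add (comp HasFiniteBreaks.of_abs (h₂.sub h₁))).mul (const _)

theorem integral_sq_sum_relu {ι : Type*} [Fintype ι] {f p : ℝ → ℝ} {a b : ℝ}
    (hf : Continuous f) (hp : Continuous p) (hf' : HasFiniteBreaks f) (hp' : HasFiniteBreaks p)
    (h0 : ∀ x ∉ Set.Ioo a b, p x = 0) {c : (Fin n → ℝ) → ℝ} (hc : GenericallyPolynomial c)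
    (B : ι → ℝ) {ξ : ι → (Fin n → ℝ) → ℝ} (hξ : ∀ κ, GenericallyPolynomial (ξ κ)) :
    GenericallyPolynomial fun θ => ∫ x in Set.Ioo a b,
      (c θ + (∑ κ, B κ * max (x - ξ κ θ) 0) - f x) ^ 2 * p x := by
  have hmain : ∀ θ, ∫ x in Set.Ioo a b,
      (c θ + (∑ κ, B κ * max (x - ξ κ θ) 0) - f x) ^ 2 * p x =
      (((∫ x in Set.Ioo a b, f x * f x * p x) - 2 * (c θ * ∫ x in Set.Ioo a b, f x * p x)) +
      c θ * c θ * ∫ x in Set.Ioo a b, p x) +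
      2 * (∑ κ, B κ * (c θ * (∫ x in Set.Ioo a b, max (x - ξ κ θ) 0 * p x) -
        ∫ x in Set.Ioo a b, max (x - ξ κ θ) 0 * (f x * p x))) +
      ∑ κ, ∑ μ, B κ * B μ * ((∫ x in Set.Ioo a b,
        max (x - max (ξ κ θ) (ξ μ θ)) 0 ^ 2 * p x) + |ξ κ θ - ξ μ θ| *
        ∫ x in Set.Ioo a b, max (x - max (ξ κ θ) (ξ μ θ)) 0 * p x) := by
    intro θ
    have hpt : ∀ x, (c θ + (∑ κ, B κ * max (x - ξ κ θ) 0) - f x) ^ 2 * p x =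
        ((f x * f x * p x - 2 * (c θ * (f x * p x))) + c θ * c θ * p x) +
        2 * (∑ κ, B κ * (c θ * (max (x - ξ κ θ) 0 * p x) -
          max (x - ξ κ θ) 0 * (f x * p x))) +
        ∑ κ, ∑ μ, B κ * B μ * (max (x - max (ξ κ θ) (ξ μ θ)) 0 ^ 2 * p x +
          |ξ κ θ - ξ μ θ| * (max (x - max (ξ κ θ) (ξ μ θ)) 0 * p x)) := by
      intro x
      set S := ∑ κ, B κ * max (x - ξ κ θ) 0 with hS
      have h1 : ∑ κ, B κ * (c θ * (max (x - ξ κ θ) 0 * p x) -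
          max (x - ξ κ θ) 0 * (f x * p x)) = S * ((c θ - f x) * p x) := by
        rw [hS, Finset.sum_mul]
        exact Finset.sum_congr rfl fun κ _ => by ring
      have h2 : ∑ κ, ∑ μ, B κ * B μ * (max (x - max (ξ κ θ) (ξ μ θ)) 0 ^ 2 * p x +
          |ξ κ θ - ξ μ θ| * (max (x - max (ξ κ θ) (ξ μ θ)) 0 * p x)) = S * S * p x := by
        rw [hS, Finset.sum_mul_sum, Finset.sum_mul]
        refine Finset.sum_congr rfl fun κ _ => ?_
        rw [Finset.sum_mul]
        refine Finset.sum_congr rfl fun μ _ => ?_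
        linear_combination (-B κ * B μ * p x) * relu_mul_relu x (ξ κ θ) (ξ μ θ)
      rw [h1, h2]
      ring
    simp only [hpt]
    have hint : ∀ g : ℝ → ℝ, Continuous g → IntegrableOn g (Set.Ioo a b) :=
      fun g hg => hg.integrableOn_Ioo_real a b
    have hr : ∀ κ, Continuous fun x => max (x - ξ κ θ) 0 := fun κ => by fun_prop
    rw [integral_add, integral_add, integral_add, integral_sub, integral_const_mul,
      integral_const_mul, integral_const_mul, integral_const_mul, integral_finsetSum,
      integral_finsetSum]
    · congr 2
      · congr 1
        refine Finset.sum_congr rfl fun κ _ => ?_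
        rw [integral_const_mul, integral_sub, integral_const_mul]
        all_goals exact hint _ (by fun_prop)
      · funext κ
        rw [integral_finsetSum]
        · refine Finset.sum_congr rfl fun μ _ => ?_
          rw [integral_const_mul, integral_add, integral_const_mul]
          all_goals exact hint _ (by fun_prop)
        · intro μ _
          exact hint _ (by fun_prop)
    all_goals first | exact hint _ (by fun_prop) | (intro κ _; exact hint _ (by fun_prop))
  simp only [hmain]
  have h0f : ∀ x ∉ Set.Ioo a b, f x * p x = 0 := fun x hx => by rw [h0 x hx, mul_zero]
  have hr1 : ∀ κ, GenericallyPolynomial fun θ =>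
      ∫ x in Set.Ioo a b, max (x - ξ κ θ) 0 * p x :=
    fun κ => comp (HasFiniteBreaks.integral_relu h0 hp hp') (hξ κ)
  have hr2 : ∀ κ, GenericallyPolynomial fun θ =>
      ∫ x in Set.Ioo a b, max (x - ξ κ θ) 0 * (f x * p x) :=
    fun κ => comp (HasFiniteBreaks.integral_relu h0f (hf.mul hp) (hf'.mul hp')) (hξ κ)
  refine ((((const _).sub ((const 2).mul (hc.mul (const _)))).add
    ((hc.mul hc).mul (const _))).add ((const 2).mul (sum _ fun κ _ => (const _).mul
      ((hc.mul (hr1 κ)).sub (hr2 κ))))).add (sum _ fun κ _ => sum _ fun μ _ =>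
        (const _).mul (add ?_ (mul ?_ ?_)))
  · exact comp (HasFiniteBreaks.integral_relu_sq h0 hp hp') ((hξ κ).of_max (hξ μ))
  · exact comp HasFiniteBreaks.of_abs ((hξ κ).sub (hξ μ))
  · exact comp (HasFiniteBreaks.integral_relu h0 hp hp') ((hξ κ).of_max (hξ μ))

end GenericallyPolynomial

theorem clipFn_eq_sub (u : ℝ) : clipFn u = max u 0 - max (u - 1) 0 := by
  unfold clipFn
  rcases le_total u 0 with h | h
  · rw [max_eq_right h, max_eq_right (by linarith), min_eq_left zero_le_one, sub_zero]
  · rw [max_eq_left h]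
    rcases le_total u 1 with h1 | h1
    · rw [min_eq_left h1, max_eq_right (by linarith), sub_zero]
    · rw [min_eq_right h1, max_eq_left (by linarith)]; ring

theorem clipFn_affine {w : ℝ} (hw : 0 < w) (β x : ℝ) : clipFn (w * x + β) =
    w * max (x - -β * w⁻¹) 0 - w * max (x - (1 - β) * w⁻¹) 0 := by
  rw [clipFn_eq_sub, mul_max_of_nonneg _ _ hw.le, mul_max_of_nonneg _ _ hw.le, mul_zero]
  congr 2 <;> field_simp <;> ring

theorem genericallyPolynomial_riskC {a b : ℝ} {h : ℕ} {v w : Fin h → ℝ} (hw : ∀ i, 0 < w i)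
    {f p : ℝ → ℝ} (hf : Continuous f) (hp : Continuous p) (hf' : HasFiniteBreaks f)
    (hp' : HasFiniteBreaks p) (h0 : ∀ x ∉ Set.Ioo a b, p x = 0) :
    GenericallyPolynomial (riskC a b v w f p) := by
  have key := GenericallyPolynomial.integral_sq_sum_relu (ι := Fin h ⊕ Fin h) hf hp hf' hp' h0
    (GenericallyPolynomial.coord (Fin.last h)) (Sum.elim (fun i => v i * w i) fun i => -(v i * w i))
    (ξ := Sum.elim (fun i θ => (0 - θ i.castSucc) * (w i)⁻¹)
      fun i θ => (1 - θ i.castSucc) * (w i)⁻¹)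
    (by
      rintro (i | i)
      · exact ((GenericallyPolynomial.const 0).sub (.coord _)).mul (.const _)
      · exact ((GenericallyPolynomial.const 1).sub (.coord _)).mul (.const _))
  convert key using 2 with θ
  unfold riskC realC
  simp only [Fintype.sum_sum_type, Sum.elim_inl, Sum.elim_inr, clipFn_affine (hw _), zero_sub,
    ← Finset.sum_add_distrib]
  congr 1
  funext x
  congr 4
  exact Finset.sum_congr rfl fun i _ => by ring

/-- The derivative of the clipping function away from its two kinks. -/
def clipDeriv (u : ℝ) : ℝ := Set.indicator (Set.Ioo 0 1) 1 u

/-- The partial derivatives of the realization function away from the kinks. -/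
def realCDeriv {h : ℕ} (v w : Fin h → ℝ) (θ : Fin (h + 1) → ℝ) (x : ℝ) : Fin (h + 1) → ℝ :=
  Fin.lastCases 1 fun i => v i * clipDeriv (w i * x + θ i.castSucc)

section Clipping
open Topology

@[fun_prop]
theorem continuous_clipFn : Continuous clipFn := by
  unfold clipFn
  fun_prop

theorem clipFn_nonneg (u : ℝ) : 0 ≤ clipFn u := le_min (le_max_right _ _) zero_le_one

theorem clipFn_le_one (u : ℝ) : clipFn u ≤ 1 := min_le_right _ _

theorem abs_clipFn_sub_le (u u' : ℝ) : |clipFn u - clipFn u'| ≤ |u - u'| := by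
  unfold clipFn
  exact (abs_min_sub_min_le_max _ _ _ _).trans (max_le
    ((abs_max_sub_max_le_max _ _ _ _).trans (by simp)) (by simp))

@[fun_prop]
theorem measurable_clipDeriv : Measurable clipDeriv :=
  measurable_one.indicator measurableSet_Ioo

theorem abs_clipDeriv_le (u : ℝ) : |clipDeriv u| ≤ 1 := by
  unfold clipDeriv Set.indicator
  split_ifs <;> simp

theorem exists_eventuallyEq_clipFn {u : ℝ} (h0 : u ≠ 0) (h1 : u ≠ 1) :
    (clipFn =ᶠ[𝓝 u] fun y => clipDeriv u * y + (if u ≤ 1 then 0 else 1)) ∧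
      clipDeriv =ᶠ[𝓝 u] fun _ => clipDeriv u := by
  unfold clipFn clipDeriv Set.indicator
  simp only [Set.mem_Ioo, Pi.one_apply]
  rcases lt_or_gt_of_ne h0 with h | h
  · constructor <;> filter_upwards [gt_mem_nhds h] with y hy
    · rw [if_neg (by rintro ⟨h', -⟩; linarith), if_pos (by linarith), max_eq_right hy.le]
      simp
    · rw [if_neg (by rintro ⟨h', -⟩; linarith), if_neg (by rintro ⟨h', -⟩; linarith)]
  rcases lt_or_gt_of_ne h1 with h' | h'
  · constructor <;> filter_upwards [lt_mem_nhds h, gt_mem_nhds h'] with y hy hy'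
    · rw [if_pos ⟨h, h'⟩, if_pos h'.le, max_eq_left hy.le, min_eq_left hy'.le]
      simp
    · rw [if_pos ⟨hy, hy'⟩, if_pos ⟨h, h'⟩]
  · constructor <;> filter_upwards [lt_mem_nhds h'] with y hy
    · rw [if_neg (by rintro ⟨-, h'⟩; linarith), if_neg (by linarith),
        min_eq_right (hy.le.trans (le_max_left _ _))]
      simp
    · rw [if_neg (by rintro ⟨-, h'⟩; linarith), if_neg (by rintro ⟨-, h'⟩; linarith)]

theorem hasDerivAt_clipFn {u : ℝ} (h0 : u ≠ 0) (h1 : u ≠ 1) :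
    HasDerivAt clipFn (clipDeriv u) u := by
  refine HasDerivAt.congr_of_eventuallyEq ?_ (exists_eventuallyEq_clipFn h0 h1).1
  simpa using ((hasDerivAt_id u).const_mul (clipDeriv u)).add_const (if u ≤ 1 then (0 : ℝ) else 1)

variable {h : ℕ} {a b : ℝ} {v w : Fin h → ℝ} {f p : ℝ → ℝ}

theorem abs_realC_le (hv : ∀ i, 0 < v i) (θ : Fin (h + 1) → ℝ) (x : ℝ) :
    |realC v w θ x| ≤ |θ (Fin.last h)| + ∑ i, v i := by
  unfold realC
  refine (abs_add_le _ _).trans (add_le_add_right ?_ _)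
  refine (Finset.abs_sum_le_sum_abs _ _).trans (Finset.sum_le_sum fun i _ => ?_)
  rw [abs_mul, abs_of_pos (hv i), abs_of_nonneg (clipFn_nonneg _)]
  exact mul_le_of_le_one_right (hv i).le (clipFn_le_one _)

theorem abs_realC_sub_le (hv : ∀ i, 0 < v i) (θ θ' : Fin (h + 1) → ℝ) (x : ℝ) :
    |realC v w θ x - realC v w θ' x| ≤ (1 + ∑ i, v i) * dist θ θ' := by
  have hd : ∀ k, |θ k - θ' k| ≤ dist θ θ' := fun k => by
    rw [← Real.dist_eq]; exact dist_le_pi_dist θ θ' k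
  unfold realC
  rw [add_sub_add_comm, ← Finset.sum_sub_distrib, add_mul, one_mul, Finset.sum_mul]
  refine (abs_add_le _ _).trans (add_le_add (hd _) ?_)
  refine (Finset.abs_sum_le_sum_abs _ _).trans (Finset.sum_le_sum fun i _ => ?_)
  rw [← mul_sub, abs_mul, abs_of_pos (hv i)]
  refine mul_le_mul_of_nonneg_left ((abs_clipFn_sub_le _ _).trans ?_) (hv i).le
  rw [add_sub_add_left_eq_sub]
  exact hd _

theorem abs_realCDeriv_le (hv : ∀ i, 0 < v i) (θ : Fin (h + 1) → ℝ) (x : ℝ) (k : Fin (h + 1)) :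
    |realCDeriv v w θ x k| ≤ 1 + ∑ i, v i := by
  have hs : 0 ≤ ∑ i, v i := Finset.sum_nonneg fun i _ => (hv i).le
  unfold realCDeriv
  cases k using Fin.lastCases with
  | last => simp [hs]
  | cast i =>
    rw [Fin.lastCases_castSucc, abs_mul, abs_of_pos (hv i)]
    have h1 : v i ≤ ∑ i, v i :=
      Finset.single_le_sum (fun i _ => (hv i).le) (Finset.mem_univ i)
    have h2 := mul_le_of_le_one_right (hv i).le (abs_clipDeriv_le (w i * x + θ i.castSucc))
    linarith

theorem measurable_realCDeriv (θ : Fin (h + 1) → ℝ) (k : Fin (h + 1)) :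
    Measurable fun x => realCDeriv v w θ x k := by
  unfold realCDeriv
  cases k using Fin.lastCases with
  | last => simp
  | cast i =>
    simp only [Fin.lastCases_castSucc]
    fun_prop

theorem continuous_realC (θ : Fin (h + 1) → ℝ) : Continuous (realC v w θ) := by
  unfold realC
  fun_prop

theorem ae_ne_kink (hw : ∀ i, 0 < w i) (θ : Fin (h + 1) → ℝ) (s : Set ℝ) :
    ∀ᵐ x ∂volume.restrict s, ∀ i, w i * x + θ i.castSucc ≠ 0 ∧ w i * x + θ i.castSucc ≠ 1 := by
  refine ae_restrict_of_ae (ae_all_iff.2 fun i => ?_)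
  have h1 : ∀ c : ℝ, ∀ᵐ x, w i * x + θ i.castSucc ≠ c := fun c => by
    filter_upwards [Measure.ae_ne volume ((c - θ i.castSucc) / w i)] with x hx hc
    exact hx (by rw [eq_div_iff (hw i).ne']; linarith)
  filter_upwards [h1 0, h1 1] with x h0 h1 using ⟨h0, h1⟩

theorem hasFDerivAt_realC {θ : Fin (h + 1) → ℝ} {x : ℝ}
    (hx : ∀ i, w i * x + θ i.castSucc ≠ 0 ∧ w i * x + θ i.castSucc ≠ 1) :
    HasFDerivAt (fun θ => realC v w θ x) (∑ k, realCDeriv v w θ x k •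
      ContinuousLinearMap.proj (R := ℝ) (φ := fun _ : Fin (h + 1) => ℝ) k) θ := by
  unfold realC
  have hproj : ∀ k : Fin (h + 1), HasFDerivAt (fun θ : Fin (h + 1) → ℝ => θ k)
      (ContinuousLinearMap.proj (R := ℝ) (φ := fun _ : Fin (h + 1) => ℝ) k) θ :=
    fun k => hasFDerivAt_apply k θ
  have hs := HasFDerivAt.fun_sum (u := Finset.univ) fun (i : Fin h) _ =>
    ((hasDerivAt_clipFn (hx i).1 (hx i).2).comp_hasFDerivAt θ
      ((hproj i.castSucc).const_add (w i * x))).const_mul (v i)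
  refine ((hproj (Fin.last h)).add hs).congr_fderiv ?_
  rw [Fin.sum_univ_castSucc]
  refine (add_comm _ _).trans ?_
  simp [realCDeriv, mul_smul]

theorem continuousAt_realCDeriv {θ : Fin (h + 1) → ℝ} {x : ℝ}
    (hx : ∀ i, w i * x + θ i.castSucc ≠ 0 ∧ w i * x + θ i.castSucc ≠ 1) (k : Fin (h + 1)) :
    ContinuousAt (fun θ => realCDeriv v w θ x k) θ := by
  unfold realCDeriv
  cases k using Fin.lastCases with
  | last => simpa using continuousAt_const
  | cast i =>
    simp only [Fin.lastCases_castSucc]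
    refine continuousAt_const.mul ?_
    have hc : ContinuousAt clipDeriv (w i * x + θ i.castSucc) :=
      continuousAt_const.congr (exists_eventuallyEq_clipFn (hx i).1 (hx i).2).2.symm
    have hg : ContinuousAt (fun θ : Fin (h + 1) → ℝ => w i * x + θ i.castSucc) θ :=
      (continuous_const.add (continuous_apply i.castSucc)).continuousAt
    exact ContinuousAt.comp (f := fun θ : Fin (h + 1) → ℝ => w i * x + θ i.castSucc) hc hg

theorem abs_last_le {θ θ₀ : Fin (h + 1) → ℝ} (hθ : θ ∈ Metric.ball θ₀ 1) :
    |θ (Fin.last h)| ≤ ‖θ₀‖ + 1 := by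
  have h1 : |θ (Fin.last h)| ≤ ‖θ‖ := norm_le_pi_norm θ _
  have h2 := norm_le_insert' θ θ₀
  rw [Metric.mem_ball, dist_eq_norm] at hθ
  linarith

theorem abs_sq_realC_sub_le (hv : ∀ i, 0 < v i) (hpnn : ∀ x, 0 ≤ p x)
    {θ θ' θ₀ : Fin (h + 1) → ℝ} (hθ : θ ∈ Metric.ball θ₀ 1) (hθ' : θ' ∈ Metric.ball θ₀ 1)
    (x : ℝ) : |(realC v w θ x - f x) ^ 2 * p x - (realC v w θ' x - f x) ^ 2 * p x| ≤
      (1 + ∑ i, v i) * (2 * ((‖θ₀‖ + 1 + ∑ i, v i) + |f x|)) * p x * dist θ θ' := by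
  have hs : 0 ≤ ∑ i, v i := Finset.sum_nonneg fun i _ => (hv i).le
  have h1 := abs_realC_sub_le (w := w) hv θ θ' x
  have h2 := (abs_realC_le (w := w) hv θ x).trans (add_le_add_left (abs_last_le hθ) _)
  have h3 := (abs_realC_le (w := w) hv θ' x).trans (add_le_add_left (abs_last_le hθ') _)
  have h4 : (realC v w θ x - f x) ^ 2 * p x - (realC v w θ' x - f x) ^ 2 * p x =
    (realC v w θ x - realC v w θ' x) * ((realC v w θ x - f x) + (realC v w θ' x - f x)) * p x := by
    ring
  have h5 : |(realC v w θ x - f x) + (realC v w θ' x - f x)| ≤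
      2 * ((‖θ₀‖ + 1 + ∑ i, v i) + |f x|) := by
    have := abs_add_le (realC v w θ x - f x) (realC v w θ' x - f x)
    have := abs_sub (realC v w θ x) (f x)
    have := abs_sub (realC v w θ' x) (f x)
    linarith
  have h6 := hpnn x
  rw [h4, abs_mul, abs_mul, abs_of_nonneg h6]
  calc _ ≤ ((1 + ∑ i, v i) * dist θ θ') * (2 * ((‖θ₀‖ + 1 + ∑ i, v i) + |f x|)) * p x := by
        gcongr
    _ = _ := by ring

theorem _root_.MeasureTheory.integral_sum_smul_const {ι α E : Type*} [Fintype ι]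
    [MeasurableSpace α] {μ : Measure α} [NormedAddCommGroup E] [NormedSpace ℝ E] [CompleteSpace E]
    {g : ι → α → ℝ} (hg : ∀ k, Integrable (g k) μ) (e : ι → E) :
    Integrable (fun x => ∑ k, g k x • e k) μ ∧
      ∫ x, ∑ k, g k x • e k ∂μ = ∑ k, (∫ x, g k x ∂μ) • e k := by
  refine ⟨integrable_finsetSum _ fun k _ => (hg k).smul_const _, ?_⟩
  rw [integral_finsetSum _ fun k _ => (hg k).smul_const _]
  exact Finset.sum_congr rfl fun k _ => integral_smul_const _ _

theorem hasFDerivAt_riskC_integral (hv : ∀ i, 0 < v i) (hw : ∀ i, 0 < w i) (hf : Continuous f)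
    (hp : Continuous p) (hpnn : ∀ x, 0 ≤ p x) (θ₀ : Fin (h + 1) → ℝ) :
    HasFDerivAt (riskC a b v w f p) (∑ k, (∫ x in Set.Ioo a b,
      2 * (realC v w θ₀ x - f x) * p x * realCDeriv v w θ₀ x k) •
      ContinuousLinearMap.proj (R := ℝ) (φ := fun _ : Fin (h + 1) => ℝ) k) θ₀ := by
  have hs : 0 ≤ ∑ i, v i := Finset.sum_nonneg fun i _ => (hv i).le
  have hint : ∀ k, Integrable (fun x => 2 * (realC v w θ₀ x - f x) * p x *
      realCDeriv v w θ₀ x k) (volume.restrict (Set.Ioo a b)) := fun k => by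
    have hc : Continuous fun x => 2 * (realC v w θ₀ x - f x) * p x := by
      have := continuous_realC (v := v) (w := w) θ₀
      fun_prop
    refine (hc.integrableOn_Ioo_real a b).mul_bdd (c := 1 + ∑ i, v i)
      (measurable_realCDeriv θ₀ k).aestronglyMeasurable ?_
    exact Eventually.of_forall fun x => abs_realCDeriv_le hv θ₀ x k
  obtain ⟨hsum, hsum'⟩ := integral_sum_smul_const hint
    fun k => ContinuousLinearMap.proj (R := ℝ) (φ := fun _ : Fin (h + 1) => ℝ) k
  have hcont : ∀ θ, Continuous fun x => (realC v w θ x - f x) ^ 2 * p x := fun θ => by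
    have := continuous_realC (v := v) (w := w) θ
    fun_prop
  set bound : ℝ → ℝ := fun x => (1 + ∑ i, v i) * (2 * ((‖θ₀‖ + 1 + ∑ i, v i) + |f x|)) * p x
    with hbound
  have hb : ∀ x, 0 ≤ bound x := fun x => by
    have := hpnn x
    positivity
  have hbc : Continuous bound := by fun_prop
  have hlip : ∀ x, LipschitzOnWith (Real.nnabs (bound x))
      (fun θ => (realC v w θ x - f x) ^ 2 * p x) (Metric.ball θ₀ 1) := fun x =>
    LipschitzOnWith.of_dist_le_mul fun θ hθ θ' hθ' => by
      rw [Real.coe_nnabs, abs_of_nonneg (hb x), Real.dist_eq]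
      exact abs_sq_realC_sub_le hv hpnn hθ hθ' x
  have hdiff : ∀ᵐ x ∂volume.restrict (Set.Ioo a b),
      HasFDerivAt (fun θ => (realC v w θ x - f x) ^ 2 * p x)
        (∑ k, (2 * (realC v w θ₀ x - f x) * p x * realCDeriv v w θ₀ x k) •
      ContinuousLinearMap.proj (R := ℝ) (φ := fun _ : Fin (h + 1) => ℝ) k) θ₀ := by
    filter_upwards [ae_ne_kink hw θ₀ (Set.Ioo a b)] with x hx
    have hd := ((hasFDerivAt_realC (v := v) hx).sub_const (f x))
    refine ((hd.pow 2).mul_const (p x)).congr_fderiv ?_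
    rw [Finset.smul_sum, Finset.smul_sum]
    refine Finset.sum_congr rfl fun k _ => ?_
    rw [smul_smul, smul_smul]
    congr 1
    simp only [pow_one, Nat.add_one_sub_one, Nat.cast_ofNat, nsmul_eq_mul]
    ring
  have key := (hasFDerivAt_integral_of_dominated_loc_of_lip
    (Metric.ball_mem_nhds θ₀ one_pos)
    (Eventually.of_forall fun θ => (hcont θ).aestronglyMeasurable)
    ((hcont θ₀).integrableOn_Ioo_real a b) hsum.aestronglyMeasurable
    (Eventually.of_forall hlip) (hbc.integrableOn_Ioo_real a b) hdiff).2
  rwa [hsum'] at key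

theorem gradC_eq_integral (hv : ∀ i, 0 < v i) (hw : ∀ i, 0 < w i) (hf : Continuous f)
    (hp : Continuous p) (hpnn : ∀ x, 0 ≤ p x) (θ : Fin (h + 1) → ℝ) (k : Fin (h + 1)) :
    gradC a b v w f p θ k = ∫ x in Set.Ioo a b,
      2 * (realC v w θ x - f x) * p x * realCDeriv v w θ x k := by
  unfold gradC
  rw [(hasFDerivAt_riskC_integral hv hw hf hp hpnn θ).fderiv]
  simp [sum_apply, Pi.single_apply]

theorem hasFDerivAt_riskC (hv : ∀ i, 0 < v i) (hw : ∀ i, 0 < w i) (hf : Continuous f)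
    (hp : Continuous p) (hpnn : ∀ x, 0 ≤ p x) (θ : Fin (h + 1) → ℝ) :
    HasFDerivAt (riskC a b v w f p) (∑ k, gradC a b v w f p θ k •
      ContinuousLinearMap.proj (R := ℝ) (φ := fun _ : Fin (h + 1) => ℝ) k) θ := by
  simp only [gradC_eq_integral hv hw hf hp hpnn]
  exact hasFDerivAt_riskC_integral hv hw hf hp hpnn θ

theorem continuous_gradC (hv : ∀ i, 0 < v i) (hw : ∀ i, 0 < w i) (hf : Continuous f)
    (hp : Continuous p) (hpnn : ∀ x, 0 ≤ p x) : Continuous (gradC a b v w f p) := by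
  have hs : 0 ≤ ∑ i, v i := Finset.sum_nonneg fun i _ => (hv i).le
  refine continuous_pi fun k => ?_
  simp only [gradC_eq_integral hv hw hf hp hpnn]
  refine continuous_iff_continuousAt.2 fun θ₀ => continuousAt_of_dominated
    (bound := fun x => 2 * ((‖θ₀‖ + 1 + ∑ i, v i) + |f x|) * p x * (1 + ∑ i, v i)) ?_ ?_ ?_ ?_
  · refine Eventually.of_forall fun θ => AEStronglyMeasurable.mul
      (Continuous.aestronglyMeasurable ?_) (measurable_realCDeriv θ k).aestronglyMeasurable
    have := continuous_realC (v := v) (w := w) θ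
    fun_prop
  · filter_upwards [Metric.ball_mem_nhds θ₀ one_pos] with θ hθ
    refine Eventually.of_forall fun x => ?_
    have h1 := (abs_realC_le (w := w) hv θ x).trans (add_le_add_left (abs_last_le hθ) _)
    have h2 := abs_sub (realC v w θ x) (f x)
    have h3 := hpnn x
    rw [Real.norm_eq_abs, abs_mul, abs_mul, abs_mul, abs_two, abs_of_nonneg h3]
    gcongr
    · linarith
    · exact abs_realCDeriv_le hv θ x k
  · exact Continuous.integrableOn_Ioo_real (by fun_prop) a b
  · filter_upwards [ae_ne_kink hw θ₀ (Set.Ioo a b)] with x hx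
    refine ContinuousAt.mul ?_ (continuousAt_realCDeriv hx k)
    exact ((((hasFDerivAt_realC (v := v) hx).continuousAt.sub continuousAt_const).const_mul 2).mul
      continuousAt_const)

theorem gradC_castSucc_eq_zero (hv : ∀ i, 0 < v i) (hw : ∀ i, 0 < w i) (hf : Continuous f)
    (hp : Continuous p) (hpnn : ∀ x, 0 ≤ p x) {θ : Fin (h + 1) → ℝ} {i : Fin h}
    (hθ : 1 - w i * a ≤ θ i.castSucc ∨ θ i.castSucc ≤ -(w i * b)) :
    gradC a b v w f p θ i.castSucc = 0 := by
  rw [gradC_eq_integral hv hw hf hp hpnn]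
  refine setIntegral_eq_zero_of_forall_eq_zero fun x hx => ?_
  have h1 : w i * a < w i * x := mul_lt_mul_of_pos_left hx.1 (hw i)
  have h2 : w i * x < w i * b := mul_lt_mul_of_pos_left hx.2 (hw i)
  have h3 : clipDeriv (w i * x + θ i.castSucc) = 0 := by
    refine Set.indicator_of_notMem (fun hmem => ?_) _
    rcases hθ with hθ | hθ
    · linarith [hmem.2]
    · linarith [hmem.1]
  simp [realCDeriv, h3]

end Clipping

namespace GradientFlow

open Topology

theorem hasDerivWithinAt_of_eq_integral {n : ℕ} {Θ : ℝ → Fin n → ℝ}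
    {G : (Fin n → ℝ) → Fin n → ℝ} (hG : Continuous G) (hΘ : ContinuousOn Θ (Set.Ici 0))
    (hflow : ∀ t, 0 ≤ t → Θ t = Θ 0 - ∫ s in Set.Icc (0 : ℝ) t, G (Θ s)) {t : ℝ} (ht : 0 ≤ t) :
    HasDerivWithinAt Θ (-G (Θ t)) (Set.Ici t) t := by
  have hc : Continuous fun s => G (Θ (max s 0)) :=
    hG.comp (hΘ.comp_continuous (by fun_prop) fun s => le_max_right s 0)
  have hd : HasDerivAt (fun u => Θ 0 - ∫ s in (0 : ℝ)..u, G (Θ (max s 0)))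
      (-G (Θ (max t 0))) t :=
    (intervalIntegral.integral_hasDerivAt_right (hc.intervalIntegrable _ _)
      (hc.stronglyMeasurableAtFilter _ _) hc.continuousAt).const_sub _
  have heq : ∀ u, 0 ≤ u → Θ u = Θ 0 - ∫ s in (0 : ℝ)..u, G (Θ (max s 0)) := fun u hu => by
    rw [hflow u hu, intervalIntegral.integral_of_le hu, integral_Icc_eq_integral_Ioc]
    congr 1
    exact setIntegral_congr_fun measurableSet_Ioc fun s hs => by simp only [max_eq_left hs.1.le]
  rw [max_eq_left ht] at hd
  exact hd.hasDerivWithinAt.congr (fun u hu => heq u (ht.trans hu)) (heq t ht)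

theorem le_of_right_deriv_eq_zero {u u' : ℝ → ℝ} {m : ℝ} (hu : ContinuousOn u (Set.Ici 0))
    (hu' : ∀ t, 0 ≤ t → HasDerivWithinAt u (u' t) (Set.Ici t) t) (h0 : u 0 ≤ m)
    (hz : ∀ t, 0 ≤ t → m ≤ u t → u' t = 0) {t : ℝ} (ht : 0 ≤ t) : u t ≤ m := by
  have key : ∀ ε > 0, u t ≤ m + ε * t := fun ε hε => by
    refine image_le_of_deriv_right_lt_deriv_boundary (f' := u') (B := fun s => m + ε * s)
      (B' := fun _ => ε) (hu.mono Set.Icc_subset_Ici_self) (fun s hs => hu' s hs.1) (by simpa)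
      (fun s => by simpa using ((hasDerivAt_id s).const_mul ε).const_add m) (fun s hs he => ?_)
      (Set.right_mem_Icc.2 ht)
    rw [hz s hs.1 (by rw [he]; nlinarith [hs.1])]
    exact hε
  have hlim : Tendsto (fun ε : ℝ => m + ε * t) (𝓝[>] 0) (𝓝 m) := by
    have : Tendsto (fun ε : ℝ => m + ε * t) (𝓝 0) (𝓝 (m + 0 * t)) :=
      Continuous.tendsto (by fun_prop) 0
    simpa using this.mono_left nhdsWithin_le_nhds
  exact ge_of_tendsto hlim (eventually_mem_nhdsWithin.mono key)

variable {n : ℕ} {L : (Fin n → ℝ) → ℝ} {G : (Fin n → ℝ) → Fin n → ℝ} {Θ : ℝ → Fin n → ℝ}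

theorem norm_le_sqrt_sum_sq (x : Fin n → ℝ) : ‖x‖ ≤ √(∑ i, x i ^ 2) :=
  (pi_norm_le_iff_of_nonneg (Real.sqrt_nonneg _)).2 fun i =>
    Real.abs_le_sqrt (Finset.single_le_sum (f := fun i => x i ^ 2) (fun _ _ => sq_nonneg _)
      (Finset.mem_univ i))

theorem hasDerivWithinAt_comp
    (hd : ∀ θ, HasFDerivAt L (∑ i, G θ i •
      ContinuousLinearMap.proj (R := ℝ) (φ := fun _ : Fin n => ℝ) i) θ)
    (hΘ' : ∀ t, 0 ≤ t → HasDerivWithinAt Θ (-G (Θ t)) (Set.Ici t) t) {t : ℝ} (ht : 0 ≤ t) :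
    HasDerivWithinAt (fun s => L (Θ s)) (-∑ i, G (Θ t) i ^ 2) (Set.Ici t) t := by
  refine ((hd (Θ t)).comp_hasDerivWithinAt t (hΘ' t ht)).congr_deriv ?_
  simp [sum_apply, sq]

theorem antitoneOn_comp
    (hd : ∀ θ, HasFDerivAt L (∑ i, G θ i •
      ContinuousLinearMap.proj (R := ℝ) (φ := fun _ : Fin n => ℝ) i) θ)
    (hΘ : ContinuousOn Θ (Set.Ici 0))
    (hΘ' : ∀ t, 0 ≤ t → HasDerivWithinAt Θ (-G (Θ t)) (Set.Ici t) t) :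
    AntitoneOn (fun s => L (Θ s)) (Set.Ici 0) := by
  intro s hs t _ hst
  have hL : Continuous L := continuous_iff_continuousAt.2 fun θ => (hd θ).continuousAt
  exact image_le_of_deriv_right_le_deriv_boundary (B := fun _ => L (Θ s)) (B' := fun _ => 0)
    ((hL.comp_continuousOn hΘ).mono fun r hr => le_trans hs hr.1)
    (fun r hr => hasDerivWithinAt_comp hd hΘ' (le_trans hs hr.1)) le_rfl
    continuousOn_const (fun r _ => hasDerivWithinAt_const _ _ _)
    (fun r _ => neg_nonpos.2 (Finset.sum_nonneg fun i _ => sq_nonneg _))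
    (Set.right_mem_Icc.2 hst)

/-- Along a gradient flow that stays where the Łojasiewicz inequality holds, the distance
travelled is controlled by the decrease of a power of the energy. -/
theorem norm_sub_le_of_lojasiewicz
    (hd : ∀ θ, HasFDerivAt L (∑ i, G θ i •
      ContinuousLinearMap.proj (R := ℝ) (φ := fun _ : Fin n => ℝ) i) θ)
    (hΘ : ContinuousOn Θ (Set.Ici 0))
    (hΘ' : ∀ t, 0 ≤ t → HasDerivWithinAt Θ (-G (Θ t)) (Set.Ici t) t)
    {ℓ β s t : ℝ} (hβ : β < 1) (hs : 0 ≤ s) (hst : s ≤ t)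
    (hpos : ∀ r ∈ Set.Icc s t, ℓ < L (Θ r))
    (hloj : ∀ r ∈ Set.Ico s t, (L (Θ r) - ℓ) ^ (2 * β) ≤ ∑ i, G (Θ r) i ^ 2) :
    ‖Θ t - Θ s‖ ≤ (1 - β)⁻¹ * ((L (Θ s) - ℓ) ^ (1 - β) - (L (Θ t) - ℓ) ^ (1 - β)) := by
  have hL : Continuous L := continuous_iff_continuousAt.2 fun θ => (hd θ).continuousAt
  have hβ' : 0 < 1 - β := sub_pos.2 hβ
  have hsub : Set.Icc s t ⊆ Set.Ici 0 := fun r hr => le_trans hs hr.1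
  have hΘs := hΘ.mono hsub
  refine image_norm_le_of_norm_deriv_right_le_deriv_boundary' (f := fun r => Θ r - Θ s)
    (f' := fun r => -G (Θ r))
    (B := fun r => (1 - β)⁻¹ * ((L (Θ s) - ℓ) ^ (1 - β) - (L (Θ r) - ℓ) ^ (1 - β)))
    (B' := fun r => (L (Θ r) - ℓ) ^ (-β) * ∑ i, G (Θ r) i ^ 2)
    (hΘs.sub continuousOn_const) (fun r hr => (hΘ' r (hs.trans hr.1)).sub_const _) (by simp) ?_ ?_
    ?_ (Set.right_mem_Icc.2 hst)
  · refine continuousOn_const.mul (continuousOn_const.sub (ContinuousOn.rpow_const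
      ((hL.comp_continuousOn hΘs).sub continuousOn_const) fun r hr => Or.inr hβ'.le))
  · intro r hr
    have hp := sub_pos.2 (hpos r ⟨hr.1, hr.2.le⟩)
    have h1 := ((hasDerivWithinAt_comp hd hΘ' (hs.trans hr.1)).sub_const ℓ).rpow_const
      (p := 1 - β) (Or.inl hp.ne')
    refine ((h1.const_sub ((L (Θ s) - ℓ) ^ (1 - β))).const_mul (1 - β)⁻¹).congr_deriv ?_
    rw [show 1 - β - 1 = -β by ring]
    field_simp
  · intro r hr
    have hp := sub_pos.2 (hpos r ⟨hr.1, hr.2.le⟩)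
    have h1 := hloj r hr
    have hS : 0 ≤ ∑ i, G (Θ r) i ^ 2 := Finset.sum_nonneg fun i _ => sq_nonneg _
    have h2 : (L (Θ r) - ℓ) ^ β ≤ √(∑ i, G (Θ r) i ^ 2) := by
      refine Real.le_sqrt_of_sq_le ?_
      rwa [← Real.rpow_natCast, ← Real.rpow_mul hp.le, mul_comm, Nat.cast_ofNat]
    have h3 : 1 ≤ (L (Θ r) - ℓ) ^ (-β) * √(∑ i, G (Θ r) i ^ 2) := by
      rw [Real.rpow_neg hp.le]
      exact (one_le_inv_mul₀ (Real.rpow_pos_of_pos hp _)).2 h2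
    calc ‖-G (Θ r)‖ ≤ 1 * √(∑ i, G (Θ r) i ^ 2) := by
          rw [norm_neg, one_mul]; exact norm_le_sqrt_sum_sq _
      _ ≤ (L (Θ r) - ℓ) ^ (-β) * √(∑ i, G (Θ r) i ^ 2) * √(∑ i, G (Θ r) i ^ 2) := by gcongr
      _ = _ := by rw [mul_assoc, Real.mul_self_sqrt hS]

theorem sub_le_inv_of_lojasiewicz
    (hd : ∀ θ, HasFDerivAt L (∑ i, G θ i •
      ContinuousLinearMap.proj (R := ℝ) (φ := fun _ : Fin n => ℝ) i) θ)
    (hΘ : ContinuousOn Θ (Set.Ici 0))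
    (hΘ' : ∀ t, 0 ≤ t → HasDerivWithinAt Θ (-G (Θ t)) (Set.Ici t) t)
    {ℓ β s t : ℝ} (hβ : β ≤ 1) (hs : 0 ≤ s) (hst : s ≤ t) (h1 : L (Θ s) - ℓ ≤ 1)
    (hpos : ∀ r ∈ Set.Icc s t, ℓ < L (Θ r))
    (hloj : ∀ r ∈ Set.Ico s t, (L (Θ r) - ℓ) ^ (2 * β) ≤ ∑ i, G (Θ r) i ^ 2) :
    L (Θ t) - ℓ ≤ (1 + (t - s))⁻¹ := by
  have hL : Continuous L := continuous_iff_continuousAt.2 fun θ => (hd θ).continuousAt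
  have hsub : Set.Icc s t ⊆ Set.Ici 0 := fun r hr => le_trans hs hr.1
  have hΘs := hΘ.mono hsub
  have key : 1 + (t - s) ≤ (L (Θ t) - ℓ)⁻¹ := by
    refine image_le_of_deriv_right_le_deriv_boundary (f := fun r => 1 + (r - s))
      (f' := fun _ => 1) (B := fun r => (L (Θ r) - ℓ)⁻¹)
      (B' := fun r => - -(∑ i, G (Θ r) i ^ 2) / (L (Θ r) - ℓ) ^ 2)
      (by fun_prop) (fun r _ => ?_) ?_ ?_ ?_ ?_ (Set.right_mem_Icc.2 hst)
    · exact (((hasDerivAt_id r).sub_const s).const_add 1).hasDerivWithinAt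
    · simpa using (one_le_inv₀ (sub_pos.2 (hpos s ⟨le_rfl, hst⟩))).2 h1
    · exact ((hL.comp_continuousOn hΘs).sub continuousOn_const).inv₀
        fun r hr => (sub_pos.2 (hpos r hr)).ne'
    · intro r hr
      exact ((hasDerivWithinAt_comp hd hΘ' (hs.trans hr.1)).sub_const ℓ).fun_inv
        (sub_pos.2 (hpos r ⟨hr.1, hr.2.le⟩)).ne'
    · intro r hr
      have hp := sub_pos.2 (hpos r ⟨hr.1, hr.2.le⟩)
      have hle : L (Θ r) - ℓ ≤ 1 := (sub_le_sub_right
        (antitoneOn_comp hd hΘ hΘ' hs (hs.trans hr.1) hr.1) ℓ).trans h1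
      rw [neg_neg, one_le_div (by positivity)]
      refine le_trans ?_ (hloj r hr)
      rw [← Real.rpow_natCast, Nat.cast_ofNat]
      exact Real.rpow_le_rpow_of_exponent_ge hp hle (by linarith)
  have hp := sub_pos.2 (hpos t ⟨hst, le_rfl⟩)
  exact (le_inv_comm₀ (by linarith) hp).1 key

theorem eventually_eq_of_minimum_attained
    (hd : ∀ θ, HasFDerivAt L (∑ i, G θ i •
      ContinuousLinearMap.proj (R := ℝ) (φ := fun _ : Fin n => ℝ) i) θ)
    (hΘ : ContinuousOn Θ (Set.Ici 0))
    (hΘ' : ∀ t, 0 ≤ t → HasDerivWithinAt Θ (-G (Θ t)) (Set.Ici t) t)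
    {s t : ℝ} (hs : 0 ≤ s) (hst : s ≤ t) (hmin : ∀ r, 0 ≤ r → L (Θ s) ≤ L (Θ r)) :
    Θ t = Θ s := by
  have hG : ∀ r, s ≤ r → G (Θ r) = 0 := fun r hr => by
    have h1 := hasDerivWithinAt_comp hd hΘ' (hs.trans hr)
    have h2 : HasDerivWithinAt (fun u => L (Θ u)) 0 (Set.Ici r) r :=
      (hasDerivWithinAt_const r _ (L (Θ s))).congr
        (fun u hu => le_antisymm
          (antitoneOn_comp hd hΘ hΘ' hs (hs.trans (hr.trans hu)) (hr.trans hu))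
          (hmin u (hs.trans (hr.trans hu))))
        (le_antisymm (antitoneOn_comp hd hΘ hΘ' hs (hs.trans hr) hr) (hmin r (hs.trans hr)))
    have h3 := (uniqueDiffOn_Ici r r Set.self_mem_Ici).eq_deriv _ h1 h2
    rw [neg_eq_zero, Finset.sum_eq_zero_iff_of_nonneg fun i _ => sq_nonneg _] at h3
    funext i
    exact pow_eq_zero_iff two_ne_zero |>.1 (h3 i (Finset.mem_univ i))
  refine constant_of_has_deriv_right_zero (hΘ.mono fun r hr => hs.trans hr.1) (fun r hr => ?_) t
    (Set.right_mem_Icc.2 hst)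
  simpa [hG r hr.1] using hΘ' r (hs.trans hr.1)

/-- A gradient flow trajectory that comes close enough to a limit point of small energy gap
remains in the ball where the Łojasiewicz inequality holds. -/
theorem dist_lt_of_lojasiewicz
    (hd : ∀ θ, HasFDerivAt L (∑ i, G θ i •
      ContinuousLinearMap.proj (R := ℝ) (φ := fun _ : Fin n => ℝ) i) θ)
    (hΘ : ContinuousOn Θ (Set.Ici 0))
    (hΘ' : ∀ t, 0 ≤ t → HasDerivWithinAt Θ (-G (Θ t)) (Set.Ici t) t)
    {ϑ : Fin n → ℝ} {β δ s : ℝ} (hβ : β < 1) (hs : 0 ≤ s)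
    (hpos : ∀ r, 0 ≤ r → L ϑ < L (Θ r))
    (hloj : ∀ x, dist x ϑ < δ → |L x - L ϑ| ^ (2 * β) ≤ ∑ i, G x i ^ 2)
    (hnear : dist (Θ s) ϑ < δ / 2)
    (hgap : (1 - β)⁻¹ * (L (Θ s) - L ϑ) ^ (1 - β) < δ / 2) {t : ℝ} (hst : s ≤ t) :
    dist (Θ t) ϑ < δ := by
  by_contra! hcon
  set S : Set ℝ := {r ∈ Set.Ici s | δ ≤ dist (Θ r) ϑ} with hS
  have hclosed : IsClosed S :=
    ContinuousOn.preimage_isClosed_of_isClosed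
      (f := fun r => dist (Θ r) ϑ)
      ((continuous_id.dist continuous_const).comp_continuousOn
        (hΘ.mono (Set.Ici_subset_Ici.2 hs))) isClosed_Ici isClosed_Ici
  have hbdd : BddBelow S := ⟨s, fun r hr => hr.1⟩
  have hmem : sInf S ∈ S := hclosed.csInf_mem ⟨t, hst, hcon⟩ hbdd
  have hlen := norm_sub_le_of_lojasiewicz hd hΘ hΘ' hβ hs hmem.1
    (fun r hr => hpos r (hs.trans hr.1)) fun r hr => by
      rw [← abs_of_pos (sub_pos.2 (hpos r (hs.trans hr.1)))]
      refine hloj _ ?_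
      by_contra! hcon'
      exact (csInf_le hbdd ⟨hr.1, hcon'⟩).not_gt hr.2
  have h0 : 0 ≤ (1 - β)⁻¹ * (L (Θ (sInf S)) - L ϑ) ^ (1 - β) :=
    mul_nonneg (inv_nonneg.2 (sub_pos.2 hβ).le)
      (Real.rpow_nonneg (sub_pos.2 (hpos _ (hs.trans hmem.1))).le _)
  rw [← dist_eq_norm, mul_sub] at hlen
  have h1 := dist_triangle (Θ (sInf S)) (Θ s) ϑ
  linarith [hmem.2]

/-- Convergence of bounded gradient flows under Łojasiewicz inequalities, with rates that
hold from some time on. -/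
theorem exists_limit_of_lojasiewicz
    (hd : ∀ θ, HasFDerivAt L (∑ i, G θ i •
      ContinuousLinearMap.proj (R := ℝ) (φ := fun _ : Fin n => ℝ) i) θ)
    (hΘ : ContinuousOn Θ (Set.Ici 0))
    (hΘ' : ∀ t, 0 ≤ t → HasDerivWithinAt Θ (-G (Θ t)) (Set.Ici t) t)
    (hloj : ∀ ϑ, ∃ β₀ δ : ℝ, β₀ < 1 ∧ 0 < δ ∧ ∀ x, dist x ϑ < δ → ∀ β, 0 < β → β₀ ≤ β →
      |L x - L ϑ| ^ (2 * β) ≤ ∑ i, G x i ^ 2)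
    {R : ℝ} (hR : ∀ t, 0 ≤ t → ‖Θ t‖ ≤ R) :
    ∃ (ϑ : Fin n → ℝ) (α K T : ℝ), 0 < α ∧ α ≤ 1 ∧ 0 ≤ K ∧ 0 ≤ T ∧ ‖ϑ‖ ≤ R ∧
      (∀ t, 0 ≤ t → L ϑ ≤ L (Θ t)) ∧
      ∀ t, T ≤ t → L (Θ t) - L ϑ ≤ (1 + (t - T))⁻¹ ∧
        ‖Θ t - ϑ‖ ≤ K * (L (Θ t) - L ϑ) ^ α := by
  have hL : Continuous L := continuous_iff_continuousAt.2 fun θ => (hd θ).continuousAt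
  have hanti := antitoneOn_comp hd hΘ hΘ'
  obtain ⟨ϑ, hϑ, φ, hφ, hlim⟩ := (isCompact_closedBall (0 : Fin n → ℝ) R).tendsto_subseq
    (x := fun k : ℕ => Θ k) fun k => mem_closedBall_zero_iff.2 (hR k k.cast_nonneg)
  have hφt : Tendsto (fun k => (φ k : ℝ)) atTop atTop :=
    tendsto_natCast_atTop_atTop.comp hφ.tendsto_atTop
  have hLlim : Tendsto (fun k => L (Θ (φ k))) atTop (𝓝 (L ϑ)) := (hL.tendsto ϑ).comp hlim
  have hmin : ∀ t, 0 ≤ t → L ϑ ≤ L (Θ t) := fun t ht =>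
    le_of_tendsto hLlim ((hφt.eventually_ge_atTop t).mono fun k hk =>
      hanti ht (ht.trans hk) hk)
  have hϑR := mem_closedBall_zero_iff.1 hϑ
  by_cases hatt : ∃ T, 0 ≤ T ∧ L (Θ T) = L ϑ
  · obtain ⟨T, hT, hLT⟩ := hatt
    have hconst : ∀ t, T ≤ t → Θ t = Θ T := fun t ht =>
      eventually_eq_of_minimum_attained hd hΘ hΘ' hT ht fun r hr => hLT ▸ hmin r hr
    have hϑT : ϑ = Θ T := tendsto_nhds_unique hlim
      (tendsto_const_nhds.congr' ((hφt.eventually_ge_atTop T).mono fun k hk =>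
        (hconst _ hk).symm))
    refine ⟨ϑ, 1, 0, T, one_pos, le_rfl, le_rfl, hT, hϑR, hmin, fun t ht => ?_⟩
    rw [hconst t ht, hϑT]
    simp only [sub_self, norm_zero, zero_mul, le_refl, and_true]
    exact inv_nonneg.2 (by linarith)
  have hpos : ∀ t, 0 ≤ t → L ϑ < L (Θ t) := fun t ht =>
    (hmin t ht).lt_of_ne fun he => hatt ⟨t, ht, he.symm⟩
  obtain ⟨β₀, δ, hβ₀, hδ, hineq⟩ := hloj ϑ
  set β := max β₀ 2⁻¹ with hβdef
  have hβ : β < 1 := max_lt hβ₀ (by norm_num)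
  have hβhalf : 2⁻¹ ≤ β := le_max_right _ _
  have hloj' : ∀ x, dist x ϑ < δ → |L x - L ϑ| ^ (2 * β) ≤ ∑ i, G x i ^ 2 := fun x hx =>
    hineq x hx β (by linarith [hβhalf, show (0 : ℝ) < 2⁻¹ by norm_num]) (le_max_left _ _)
  have hβ' : 0 < 1 - β := sub_pos.2 hβ
  have hgaplim : Tendsto (fun k => L (Θ (φ k)) - L ϑ) atTop (𝓝 0) := by
    simpa using hLlim.sub_const (L ϑ)
  have hpowlim : Tendsto (fun k => (1 - β)⁻¹ * (L (Θ (φ k)) - L ϑ) ^ (1 - β)) atTop (𝓝 0) := by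
    simpa [Real.zero_rpow hβ'.ne'] using
      (hgaplim.rpow_const (p := 1 - β) (Or.inr hβ'.le)).const_mul (1 - β)⁻¹
  obtain ⟨k, hk1, hk2, hk3⟩ := ((hgaplim.eventually_le_const one_pos).and
    ((hpowlim.eventually_lt_const (half_pos hδ)).and
      (hlim.eventually (Metric.ball_mem_nhds ϑ (half_pos hδ))))).exists
  have hT : (0 : ℝ) ≤ φ k := Nat.cast_nonneg _
  set T : ℝ := (φ k : ℝ)
  have hstay : ∀ t, T ≤ t → (L (Θ t) - L ϑ) ^ (2 * β) ≤ ∑ i, G (Θ t) i ^ 2 := fun t ht => by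
    rw [← abs_of_pos (sub_pos.2 (hpos t (hT.trans ht)))]
    exact hloj' _ (dist_lt_of_lojasiewicz hd hΘ hΘ' hβ hT hpos hloj' hk3 hk2 ht)
  refine ⟨ϑ, 1 - β, (1 - β)⁻¹, T, hβ', by linarith [show (0 : ℝ) < 2⁻¹ by norm_num],
    (inv_pos.2 hβ').le, hT, hϑR, hmin, fun t ht => ⟨?_, ?_⟩⟩
  · exact sub_le_inv_of_lojasiewicz hd hΘ hΘ' hβ.le hT ht hk1
      (fun r hr => hpos r (hT.trans hr.1)) fun r hr => hstay r hr.1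
  · have hlim' : Tendsto (fun j => ‖Θ (φ j) - Θ t‖) atTop (𝓝 ‖ϑ - Θ t‖) :=
      (hlim.sub_const (Θ t)).norm
    rw [norm_sub_rev]
    refine le_of_tendsto hlim' ((hφt.eventually_ge_atTop t).mono fun j hj => ?_)
    refine (norm_sub_le_of_lojasiewicz hd hΘ hΘ' hβ (hT.trans ht) hj
      (fun r hr => hpos r (hT.trans (ht.trans hr.1))) fun r hr =>
        hstay r (ht.trans hr.1)).trans ?_
    refine mul_le_mul_of_nonneg_left ?_ (inv_pos.2 hβ').le
    exact sub_le_self _ (Real.rpow_nonneg (sub_pos.2 (hpos _ (hT.trans (ht.trans hj)))).le _)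

/-- Rates valid for all times, for a bounded gradient flow under Łojasiewicz inequalities. -/
theorem exists_limit_with_rates
    (hd : ∀ θ, HasFDerivAt L (∑ i, G θ i •
      ContinuousLinearMap.proj (R := ℝ) (φ := fun _ : Fin n => ℝ) i) θ)
    (hΘ : ContinuousOn Θ (Set.Ici 0))
    (hΘ' : ∀ t, 0 ≤ t → HasDerivWithinAt Θ (-G (Θ t)) (Set.Ici t) t)
    (hloj : ∀ ϑ, ∃ β₀ δ : ℝ, β₀ < 1 ∧ 0 < δ ∧ ∀ x, dist x ϑ < δ → ∀ β, 0 < β → β₀ ≤ β →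
      |L x - L ϑ| ^ (2 * β) ≤ ∑ i, G x i ^ 2)
    {R : ℝ} (hR : ∀ t, 0 ≤ t → ‖Θ t‖ ≤ R) :
    ∃ (ϑ : Fin n → ℝ) (α C : ℝ), 0 < α ∧ 0 < C ∧ ∀ t, 0 ≤ t →
      ‖Θ t - ϑ‖ ≤ C * (1 + t) ^ (-α) ∧ L ϑ ≤ L (Θ t) ∧
        L (Θ t) - L ϑ ≤ C * (1 + t)⁻¹ := by
  obtain ⟨ϑ, α, K, T, hα, hα1, hK, hT, hϑR, hmin, hrate⟩ :=
    exists_limit_of_lojasiewicz hd hΘ hΘ' hloj hR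
  have hR0 : 0 ≤ R := (norm_nonneg _).trans hϑR
  have hE0 : 0 ≤ L (Θ 0) - L ϑ := sub_nonneg.2 (hmin 0 le_rfl)
  set D := 1 + (L (Θ 0) - L ϑ) + K + 2 * R with hD
  refine ⟨ϑ, α, (1 + T) * D, hα, by positivity, fun t ht => ?_⟩
  have ht1 : 0 < 1 + t := by linarith
  have hT1 : 0 < 1 + T := by linarith
  have hgap : ∀ {x : ℝ}, 0 ≤ x → x ≤ D → x * ((1 + T) * (1 + t)⁻¹) ≤ (1 + T) * D * (1 + t)⁻¹ :=
    fun hx0 hx => by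
      rw [mul_comm (1 + T) D, mul_assoc]
      exact mul_le_mul_of_nonneg_right hx (by positivity)
  have hdist : ∀ {x : ℝ}, 0 ≤ x → x ≤ D →
      x * ((1 + T) * (1 + t)⁻¹) ^ α ≤ (1 + T) * D * (1 + t) ^ (-α) := fun hx0 hx => by
    rw [Real.mul_rpow hT1.le (inv_nonneg.2 ht1.le), Real.inv_rpow ht1.le,
      ← Real.rpow_neg ht1.le, mul_comm (1 + T) D, mul_assoc]
    gcongr
    simpa using Real.rpow_le_rpow_of_exponent_le (by linarith : 1 ≤ 1 + T) hα1
  rcases le_total T t with hTt | hTt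
  · obtain ⟨h1, h2⟩ := hrate t hTt
    have h3 : (1 + (t - T))⁻¹ ≤ (1 + T) * (1 + t)⁻¹ := by
      rw [← div_eq_mul_inv, le_div_iff₀ ht1, inv_mul_le_iff₀ (by linarith)]
      nlinarith
    have h4 := h1.trans h3
    refine ⟨h2.trans (le_trans ?_ (hdist hK (by linarith))), hmin t ht,
      h4.trans (by simpa using hgap zero_le_one (by linarith))⟩
    exact mul_le_mul_of_nonneg_left
      (Real.rpow_le_rpow (sub_nonneg.2 (hmin t ht)) h4 hα.le) hK
  · have h3 : 1 ≤ (1 + T) * (1 + t)⁻¹ := by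
      rw [← div_eq_mul_inv, one_le_div ht1]
      linarith
    refine ⟨?_, hmin t ht, ?_⟩
    · refine le_trans ?_ (hdist (x := 2 * R) (by positivity) (by linarith))
      have h4 : ‖Θ t - ϑ‖ ≤ 2 * R := (norm_sub_le _ _).trans (by linarith [hR t ht])
      exact h4.trans (le_mul_of_one_le_right (by positivity) (Real.one_le_rpow h3 hα.le))
    · refine le_trans ?_ (hgap hE0 (by linarith))
      have h4 : L (Θ t) ≤ L (Θ 0) := antitoneOn_comp hd hΘ hΘ' Set.self_mem_Ici ht ht
      exact (sub_le_sub_right h4 _).trans (le_mul_of_one_le_right hE0 h3)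

end GradientFlow

section Clipping

open Topology

variable {a b : ℝ} {h : ℕ} {v w : Fin h → ℝ} {f p : ℝ → ℝ}

theorem sq_mul_integral_le_riskC (hv : ∀ i, 0 < v i) (hf : Continuous f)
    (hp : Continuous p) (hpnn : ∀ x, 0 ≤ p x) {F : ℝ} (hF : ∀ x ∈ Set.Icc a b, |f x| ≤ F)
    {θ : Fin (h + 1) → ℝ} {r : ℝ} (hr : 0 ≤ r)
    (hθ : ∑ i, v i + F + r ≤ |θ (Fin.last h)|) :
    r ^ 2 * ∫ x in Set.Ioo a b, p x ≤ riskC a b v w f p θ := by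
  have hN := continuous_realC (v := v) (w := w) θ
  rw [← integral_const_mul]
  refine setIntegral_mono_on (Continuous.integrableOn_Ioo_real (by fun_prop) a b)
    (Continuous.integrableOn_Ioo_real (by fun_prop) a b) measurableSet_Ioo fun x hx => ?_
  refine mul_le_mul_of_nonneg_right ?_ (hpnn x)
  have h1 := hF x ⟨hx.1.le, hx.2.le⟩
  have h2 : |θ (Fin.last h)| ≤ |realC v w θ x| + ∑ i, v i := by
    have h3 : θ (Fin.last h) = realC v w θ x -
        ∑ i, v i * clipFn (w i * x + θ i.castSucc) := by simp [realC]
    have h4 : |∑ i, v i * clipFn (w i * x + θ i.castSucc)| ≤ ∑ i, v i := by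
      refine (Finset.abs_sum_le_sum_abs _ _).trans (Finset.sum_le_sum fun i _ => ?_)
      rw [abs_mul, abs_of_pos (hv i), abs_of_nonneg (clipFn_nonneg _)]
      exact mul_le_of_le_one_right (hv i).le (clipFn_le_one _)
    calc |θ (Fin.last h)| ≤ |realC v w θ x| + |∑ i, v i * clipFn (w i * x + θ i.castSucc)| := by
          conv_lhs => rw [h3]
          exact abs_sub _ _
      _ ≤ _ := by gcongr
  have h6 := abs_sub_abs_le_abs_sub (realC v w θ x) (f x)
  rw [← sq_abs (realC v w θ x - f x)]
  exact pow_le_pow_left₀ hr (by linarith) 2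

theorem gradientFlow_bounded (hab : a < b) (hv : ∀ i, 0 < v i) (hw : ∀ i, 0 < w i)
    (hf : Continuous f) (hp : Continuous p) (hpnn : ∀ x, 0 ≤ p x)
    (hpos : ∀ x ∈ Set.Ioo a b, 0 < p x) {Θ : ℝ → Fin (h + 1) → ℝ}
    (hΘ : ContinuousOn Θ (Set.Ici 0))
    (hΘ' : ∀ t, 0 ≤ t → HasDerivWithinAt Θ (-gradC a b v w f p (Θ t)) (Set.Ici t) t) :
    ∃ R : ℝ, ∀ t, 0 ≤ t → ‖Θ t‖ ≤ R := by
  have hcoord : ∀ j : Fin (h + 1), ∃ R : ℝ, ∀ t, 0 ≤ t → |Θ t j| ≤ R := by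
    refine Fin.lastCases ?_ fun i => ?_
    · obtain ⟨F, hF⟩ := isCompact_Icc.exists_bound_of_continuousOn (s := Set.Icc a b)
        hf.continuousOn
      have hP : 0 < ∫ x in Set.Ioo a b, p x := by
        rw [← integral_Ioc_eq_integral_Ioo, ← intervalIntegral.integral_of_le hab.le]
        exact intervalIntegral.intervalIntegral_pos_of_pos_on (hp.intervalIntegrable a b) hpos hab
      set P := ∫ x in Set.Ioo a b, p x
      set s := √(riskC a b v w f p (Θ 0) / P)
      refine ⟨∑ i, v i + F + s, fun t ht => ?_⟩
      by_contra! hcon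
      set r := |Θ t (Fin.last h)| - (∑ i, v i + F) with hr
      have hsr : s < r := by linarith
      have hr0 : 0 ≤ r := (Real.sqrt_nonneg _).trans hsr.le
      have h1 := sq_mul_integral_le_riskC (w := w) hv hf hp hpnn hF (θ := Θ t) hr0 (by linarith)
      have h2 := GradientFlow.antitoneOn_comp (hasFDerivAt_riskC hv hw hf hp hpnn) hΘ hΘ'
        Set.self_mem_Ici ht ht
      have h3 : r ≤ s := Real.le_sqrt_of_sq_le ((le_div_iff₀ hP).2 (h1.trans h2))
      exact absurd h3 hsr.not_ge
    · set j := i.castSucc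
      have hd : ∀ t, 0 ≤ t → HasDerivWithinAt (fun s => Θ s j)
          (-gradC a b v w f p (Θ t) j) (Set.Ici t) t := fun t ht =>
        hasDerivWithinAt_pi.1 (hΘ' t ht) j
      have hc : ContinuousOn (fun s => Θ s j) (Set.Ici 0) :=
        (continuous_apply j).comp_continuousOn hΘ
      refine ⟨max (max (Θ 0 j) (1 - w i * a)) (max (-Θ 0 j) (w i * b)), fun t ht =>
        abs_le'.2 ⟨le_max_of_le_left ?_, le_max_of_le_right ?_⟩⟩
      · refine GradientFlow.le_of_right_deriv_eq_zero hc hd (le_max_left _ _)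
          (fun s _ hs => ?_) ht
        rw [gradC_castSucc_eq_zero hv hw hf hp hpnn (Or.inl ((le_max_right _ _).trans hs)),
          neg_zero]
      · refine GradientFlow.le_of_right_deriv_eq_zero (u := fun s => -Θ s j) hc.neg
          (fun s hs => (hd s hs).fun_neg) (le_max_left _ _) (fun s _ hs => ?_) ht
        rw [gradC_castSucc_eq_zero hv hw hf hp hpnn
          (Or.inr (by linarith [(le_max_right _ _).trans hs])), neg_zero, neg_zero]
  choose R hR using hcoord
  refine ⟨∑ j, |R j|, fun t ht => (pi_norm_le_iff_of_nonneg
    (Finset.sum_nonneg fun j _ => abs_nonneg _)).2 fun j => ?_⟩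
  exact ((hR j t ht).trans (le_abs_self _)).trans
    (Finset.single_le_sum (f := fun j => |R j|) (fun _ _ => abs_nonneg _) (Finset.mem_univ j))

theorem euclNorm_le_mul_norm {n : ℕ} (x : Fin n → ℝ) : euclNorm x ≤ n * ‖x‖ := by
  refine Real.sqrt_le_iff.2 ⟨by positivity, ?_⟩
  calc ∑ i, x i ^ 2 ≤ ∑ _i : Fin n, ‖x‖ ^ 2 := Finset.sum_le_sum fun i _ => by
        rw [← sq_abs]
        exact pow_le_pow_left₀ (abs_nonneg _) (norm_le_pi_norm x i) 2
    _ = n * ‖x‖ ^ 2 := by simp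
    _ ≤ (n * ‖x‖) ^ 2 := by
        rw [mul_pow]
        gcongr
        exact_mod_cast Nat.le_self_pow two_ne_zero n

end Clipping

theorem statement_11
    (a b : ℝ) (hab : a < b) (h : ℕ) (hh : 0 < h)
    (v w : Fin h → ℝ) (hv : ∀ i, 0 < v i) (hw : ∀ i, 0 < w i)
    (f p : ℝ → ℝ) (hf : Continuous f) (hp : Continuous p)
    (hpnn : ∀ x : ℝ, 0 ≤ p x) (hsupp : {x : ℝ | 0 < p x} = Set.Ioo a b)
    (hfpp : PiecewisePoly f) (hppp : PiecewisePoly p)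
    (Θ : ℝ → Fin (h + 1) → ℝ)
    (hcont : ContinuousOn Θ (Set.Ici 0))
    (hGF : ∀ t : ℝ, 0 ≤ t →
      Θ t = Θ 0 - ∫ s in Set.Icc (0 : ℝ) t, gradC a b v w f p (Θ s)) :
    ∃ (ϑ : Fin (h + 1) → ℝ) (α C : ℝ), 0 < α ∧ 0 < C ∧
      (∀ t : ℝ, 0 ≤ t →
        euclNorm (Θ t - ϑ) ≤ C * (1 + t) ^ (-α) ∧
        0 ≤ riskC a b v w f p (Θ t) - riskC a b v w f p ϑ ∧
        riskC a b v w f p (Θ t) - riskC a b v w f p ϑ ≤ C * (1 + t)⁻¹) ∧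
      Filter.Tendsto (fun s => euclNorm (Θ s - ϑ)) Filter.atTop (nhds 0) := by
  have h0 : ∀ x ∉ Set.Ioo a b, p x = 0 := fun x hx => by
    rw [← hsupp] at hx
    exact le_antisymm (not_lt.1 hx) (hpnn x)
  have hpos : ∀ x ∈ Set.Ioo a b, 0 < p x := fun x hx => by
    rwa [← hsupp] at hx
  have hG := continuous_gradC (a := a) (b := b) hv hw hf hp hpnn
  have hd := hasFDerivAt_riskC (a := a) (b := b) hv hw hf hp hpnn
  have hΘ' : ∀ t, 0 ≤ t → HasDerivWithinAt Θ (-gradC a b v w f p (Θ t)) (Set.Ici t) t :=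
    fun t ht => GradientFlow.hasDerivWithinAt_of_eq_integral hG hcont hGF ht
  obtain ⟨R, hR⟩ := gradientFlow_bounded hab hv hw hf hp hpnn hpos hcont hΘ'
  have hpoly := genericallyPolynomial_riskC hw hf hp (v := v)
    (HasFiniteBreaks.of_piecewisePoly hfpp) (HasFiniteBreaks.of_piecewisePoly hppp) h0
  obtain ⟨ϑ, α, C, hα, hC, hrate⟩ := GradientFlow.exists_limit_with_rates hd hcont hΘ'
    (fun ϑ => hpoly.exists_lojasiewicz hG hd ϑ) hR
  have hdist : ∀ t : ℝ, 0 ≤ t → euclNorm (Θ t - ϑ) ≤ ((h + 1 : ℕ) : ℝ) * C * (1 + t) ^ (-α) :=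
    fun t ht => (euclNorm_le_mul_norm _).trans (by
      rw [mul_assoc]
      exact mul_le_mul_of_nonneg_left (hrate t ht).1 (Nat.cast_nonneg _))
  refine ⟨ϑ, α, ((h + 1 : ℕ) : ℝ) * C, hα, by positivity, fun t ht =>
    ⟨hdist t ht, sub_nonneg.2 (hrate t ht).2.1, (hrate t ht).2.2.trans ?_⟩, ?_⟩
  · refine mul_le_mul_of_nonneg_right (le_mul_of_one_le_left hC.le ?_)
      (inv_nonneg.2 (by linarith))
    exact_mod_cast Nat.le_add_left 1 h
  · have hlim : Tendsto (fun t : ℝ => ((h + 1 : ℕ) : ℝ) * C * (1 + t) ^ (-α)) atTop (nhds 0) := by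
      simpa using ((tendsto_rpow_neg_atTop hα).comp
        (tendsto_atTop_add_const_left atTop (1 : ℝ) tendsto_id)).const_mul
          (((h + 1 : ℕ) : ℝ) * C)
    exact squeeze_zero' (Eventually.of_forall fun t => Real.sqrt_nonneg _)
      ((eventually_ge_atTop 0).mono hdist) hlim
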